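/- arXiv:2104.14651 — 3 statements merged into one kernel-verified Lean document; each statement's English description precedes it below -/
import Mathlib

section
/- Let (R, m) be an F-finite regular local ring of characteristic p > 0, q = p^e, and let P ⊂ R be a prime ideal such that R/P is regular. Then for every n ≥ 0, R^q + P^n = (R_P^q + P^n R_P) ∩ R, where R_P is the localization at P. -/
/-- A Noetherian local ring is regular when its maximal ideal is generated by a regular
sequence. -/
def IsRegularLocal (R : Type*) [CommRing R] [IsLocalRing R] : Prop :=
  IsNoetherianRing R ∧ ∃ rs : List R,
    RingTheory.Sequence.IsRegular R rs ∧
    Ideal.span {x | x ∈ rs} = IsLocalRing.maximalIdeal R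


namespace PowQ
open Ideal

section general
variable {R : Type*} [CommRing R]

lemma sup_pow_succ_le (X J : Ideal R) (n : ℕ) :
    (X ⊔ J) ^ (n + 1) ≤ X * (X ⊔ J) ^ n ⊔ J ^ (n + 1) := by
  induction n with
  | zero => simp
  | succ n ih =>
    rw [pow_succ' (X ⊔ J) (n + 1), Ideal.sup_mul]
    refine sup_le le_sup_left ?_
    calc J * (X ⊔ J) ^ (n + 1) ≤ J * (X * (X ⊔ J) ^ n ⊔ J ^ (n + 1)) := Ideal.mul_mono_right ih
      _ = X * (J * (X ⊔ J) ^ n) ⊔ J ^ (n + 2) := by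
        rw [Ideal.mul_sup, ← pow_succ' J (n + 1)]
        congr 1
        ring
      _ ≤ _ := by
        refine sup_le_sup_right (Ideal.mul_mono_right ?_) _
        rw [pow_succ']
        exact Ideal.mul_mono_left le_sup_right

lemma K_le (T X J : Ideal R) (n : ℕ) : T ⊔ (X ⊔ J) ^ n ≤ (T ⊔ X) ⊔ J ^ n := by
  cases n with
  | zero => simp
  | succ n =>
    refine sup_le (le_sup_left.trans le_sup_left) ((sup_pow_succ_le X J n).trans ?_)
    refine sup_le ?_ le_sup_right
    have h1 : X * (X ⊔ J) ^ n ≤ X := Ideal.mul_le_left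
    have h2 : X ≤ (T ⊔ X) ⊔ J ^ (n + 1) := le_sup_right.trans le_sup_left
    exact h1.trans h2

lemma J_le (T X J : Ideal R) (n : ℕ) : T ⊔ J ^ n ≤ T ⊔ (X ⊔ J) ^ n :=
  sup_le_sup_left (Ideal.pow_right_mono le_sup_right n) _

lemma decomp {T J : Ideal R} {x f : R} (h : f ∈ (T ⊔ span {x}) ⊔ J) :
    ∃ g ∈ T ⊔ J, ∃ k, f = g + x * k := by
  rw [sup_right_comm] at h
  obtain ⟨g, hg, y, hy, rfl⟩ := Submodule.mem_sup.1 h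
  obtain ⟨k, rfl⟩ := Ideal.mem_span_singleton'.1 hy
  exact ⟨g, hg, k, by ring⟩

lemma x_mul_mem {T J : Ideal R} {x f : R} {n : ℕ} (h : f ∈ T ⊔ (span {x} ⊔ J) ^ n) :
    x * f ∈ T ⊔ (span {x} ⊔ J) ^ (n + 1) := by
  obtain ⟨t, ht, y, hy, rfl⟩ := Submodule.mem_sup.1 h
  rw [mul_add]
  refine add_mem (Ideal.mem_sup_left (Ideal.mul_mem_left _ _ ht)) (Ideal.mem_sup_right ?_)
  rw [pow_succ']
  exact Ideal.mul_mem_mul (Ideal.mem_sup_left (Ideal.mem_span_singleton_self x)) hy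

lemma colon {T J : Ideal R} {x : R}
    (hp : ∀ n g, x * g ∈ T ⊔ J ^ n → g ∈ T ⊔ J ^ n) (n : ℕ) (g : R)
    (h : x * g ∈ T ⊔ (span {x} ⊔ J) ^ (n + 1)) : g ∈ T ⊔ (span {x} ⊔ J) ^ n := by
  have h1 : x * g ∈ T ⊔ (span {x} * (span {x} ⊔ J) ^ n ⊔ J ^ (n + 1)) :=
    (sup_le_sup_left (sup_pow_succ_le (span {x}) J n) T : _ ≤ _) h
  rw [sup_left_comm] at h1
  obtain ⟨y, hy, z, hz, e⟩ := Submodule.mem_sup.1 h1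
  obtain ⟨k, hk, rfl⟩ := Ideal.mem_span_singleton_mul.1 hy
  have h2 := hp (n + 1) (g - k) (by rw [mul_sub, ← e]; simpa using hz)
  have h3 : g - k ∈ T ⊔ (span {x} ⊔ J) ^ n :=
    (sup_le_sup_left (Ideal.pow_le_pow_right (Nat.le_succ n)) T : _ ≤ _) (J_le _ _ _ _ h2)
  simpa using add_mem h3 (Ideal.mem_sup_right hk)

lemma colon_pow {T J : Ideal R} {x : R}
    (hp : ∀ n g, x * g ∈ T ⊔ J ^ n → g ∈ T ⊔ J ^ n) (q n : ℕ) (g : R)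
    (h : x ^ q * g ∈ T ⊔ (span {x} ⊔ J) ^ n) : g ∈ T ⊔ (span {x} ⊔ J) ^ (n - q) := by
  induction q generalizing n with
  | zero => simpa using h
  | succ q ih =>
    cases n with
    | zero => simp
    | succ n =>
      rw [pow_succ' x, mul_assoc] at h
      have := ih n (colon hp n _ h)
      simpa using this

/-- Every subset of `S` generates, modulo `T`, a prime ideal not containing the other elements. -/
def Good (T : Ideal R) (S : Finset R) : Prop :=
  ∀ U ⊆ S, (T ⊔ span (U : Set R)).IsPrime ∧ ∀ x ∈ S, x ∉ U → x ∉ T ⊔ span (U : Set R)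

lemma span_ins [DecidableEq R] (x : R) (S : Finset R) :
    span ((insert x S : Finset R) : Set R) = span {x} ⊔ span (S : Set R) := by
  rw [Finset.coe_insert, Ideal.span_insert]

lemma Good.left [DecidableEq R] {T : Ideal R} {S : Finset R} {x : R} (h : Good T (insert x S)) :
    Good T S := fun U hU =>
  have hU' := hU.trans (Finset.subset_insert x S)
  ⟨(h U hU').1, fun y hy => (h U hU').2 y (Finset.mem_insert_of_mem hy)⟩

lemma Good.right [DecidableEq R] {T : Ideal R} {S : Finset R} {x : R} (hx : x ∉ S)
    (h : Good T (insert x S)) :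
    Good (T ⊔ span {x}) S := fun U hU => by
  have := h (insert x U) (Finset.insert_subset_insert x hU)
  rw [span_ins, ← sup_assoc] at this
  refine ⟨this.1, fun y hy hyU => this.2 y (Finset.mem_insert_of_mem hy) ?_⟩
  rw [Finset.mem_insert, not_or]
  exact ⟨fun h => hx (h ▸ hy), hyU⟩

lemma Good.x_notMem [DecidableEq R] {T : Ideal R} {S : Finset R} {x : R} (hx : x ∉ S)
    (h : Good T (insert x S)) : x ∉ T ⊔ span (S : Set R) :=
  (h S (Finset.subset_insert x S)).2 x (Finset.mem_insert_self x S) hx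

lemma prim [DecidableEq R] (S : Finset R) : ∀ T : Ideal R, Good T S → ∀ (n : ℕ) (s f : R),
    s ∉ T ⊔ span (S : Set R) → s * f ∈ T ⊔ span (S : Set R) ^ n → f ∈ T ⊔ span (S : Set R) ^ n := by
  induction S using Finset.induction_on with
  | empty =>
    intro T hT n s f hs hf
    have hp := (hT ∅ (Finset.Subset.refl _)).1
    cases n with
    | zero => simp
    | succ n =>
      simp at hs hf hp ⊢
      exact (hp.mem_or_mem hf).resolve_left hs
  | insert x S hx ih =>
    intro T hT n
    rw [span_ins]
    have hp : ∀ n g, x * g ∈ T ⊔ span (S : Set R) ^ n → g ∈ T ⊔ span (S : Set R) ^ n :=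
      fun n g => ih T hT.left n x g (hT.x_notMem hx)
    induction n with
    | zero => simp
    | succ n ihn =>
      intro s f hs hf
      obtain ⟨g, hg, k, rfl⟩ := decomp (ih _ (hT.right hx) (n + 1) s f
        (by rwa [sup_assoc]) (K_le _ _ _ _ hf))
      have hg' := J_le _ (span {x}) _ _ hg
      refine add_mem hg' (x_mul_mem (ihn s k hs (colon hp n _ ?_)))
      have := sub_mem hf (Ideal.mul_mem_left _ s hg')
      convert this using 1
      ring

lemma pow_mem_K {T J : Ideal R} {q m n : ℕ} (hq : 0 < q) (H : ∀ a b : R, (a - b) ^ q = a ^ q - b ^ q)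
    (hn : n ≤ q * m) {g : R} (hg : g ∈ T ⊔ J ^ m) : g ^ q ∈ T ⊔ J ^ n := by
  obtain ⟨t, ht, y, hy, rfl⟩ := Submodule.mem_sup.1 hg
  have e : (t + y) ^ q = t ^ q + y ^ q := by
    have := H (t + y) y
    rw [add_sub_cancel_right] at this
    rw [this]; ring
  rw [e]
  refine add_mem (Ideal.mem_sup_left (Ideal.pow_mem_of_mem _ ht _ hq)) (Ideal.mem_sup_right ?_)
  refine Ideal.pow_le_pow_right hn ?_
  rw [mul_comm, pow_mul]
  exact Ideal.pow_mem_pow hy q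

lemma ord [DecidableEq R] {q : ℕ} (hq : 0 < q) (H : ∀ a b : R, (a - b) ^ q = a ^ q - b ^ q)
    (S : Finset R) : ∀ T : Ideal R, Good T S → ∀ (m n : ℕ) (c : R), n ≤ q * m → q * m < n + q →
    c ^ q ∈ T ⊔ span (S : Set R) ^ n → c ∈ T ⊔ span (S : Set R) ^ m := by
  induction S using Finset.induction_on with
  | empty =>
    intro T hT m n c h1 h2 hc
    have hp := (hT ∅ (Finset.Subset.refl _)).1
    cases m with
    | zero => simp
    | succ m =>
      cases n with
      | zero => rw [mul_add] at h2; omega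
      | succ n =>
        simp at hc hp ⊢
        exact hp.mem_of_pow_mem _ hc
  | insert x S hx ih =>
    intro T hT m
    rw [span_ins]
    have hp : ∀ n g, x * g ∈ T ⊔ span (S : Set R) ^ n → g ∈ T ⊔ span (S : Set R) ^ n :=
      fun n g => prim S T hT.left n x g (hT.x_notMem hx)
    induction m with
    | zero => simp
    | succ m ihm =>
      intro n c h1 h2 hc
      obtain ⟨g, hg, k, rfl⟩ := decomp (ih _ (hT.right hx) (m + 1) n c h1 h2 (K_le _ _ _ _ hc))
      have hg' := J_le _ (span {x}) _ _ hg
      refine add_mem hg' (x_mul_mem (ihm (n - q) k ?_ ?_ (colon_pow hp q n _ ?_)))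
      · rw [mul_add] at h1; omega
      · rw [mul_add] at h2
        rcases le_or_gt q n with h | h
        · omega
        · have : m = 0 := by
            by_contra h0
            have : q * 1 ≤ q * m := Nat.mul_le_mul_left q (Nat.one_le_iff_ne_zero.2 h0)
            omega
          subst this; omega
      · have := sub_mem hc (pow_mem_K hq H h1 hg')
        rwa [← H, add_sub_cancel_left, mul_pow] at this

lemma main [DecidableEq R] {q : ℕ} (hq : 0 < q) (H : ∀ a b : R, (a - b) ^ q = a ^ q - b ^ q)
    (S : Finset R) : ∀ T : Ideal R, Good T S →
    (∀ s f a : R, s ∉ T ⊔ span (S : Set R) → s ^ q * f - a ^ q ∈ T ⊔ span (S : Set R) →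
      ∃ b, f - b ^ q ∈ T ⊔ span (S : Set R)) →
    ∀ (n : ℕ) (s f a : R), s ∉ T ⊔ span (S : Set R) →
      s ^ q * f - a ^ q ∈ T ⊔ span (S : Set R) ^ n → ∃ b, f - b ^ q ∈ T ⊔ span (S : Set R) ^ n := by
  have Hadd : ∀ a b : R, (a + b) ^ q = a ^ q + b ^ q := fun a b => by
    have := H (a + b) b
    rw [add_sub_cancel_right] at this
    rw [this]; ring
  induction S using Finset.induction_on with
  | empty =>
    intro T hT hb n s f a hs h
    cases n with
    | zero => simp
    | succ n =>
      simp at hb hs h ⊢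
      exact hb s f a hs h
  | insert x S hx ih =>
    intro T hT hb n s f a hs
    rw [span_ins] at *
    have hp : ∀ n g, x * g ∈ T ⊔ span (S : Set R) ^ n → g ∈ T ⊔ span (S : Set R) ^ n :=
      fun n g => prim S T hT.left n x g (hT.x_notMem hx)
    have hs' : s ∉ (T ⊔ span {x}) ⊔ span (S : Set R) := by rwa [sup_assoc]
    have hpr := (hT.right hx S (Finset.Subset.refl _)).1
    have hsq : s ^ q ∉ (T ⊔ span {x}) ⊔ span (S : Set R) := fun h => hs' (hpr.mem_of_pow_mem _ h)
    have IH := ih _ (hT.right hx) (by simpa only [sup_assoc] using hb)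
    suffices key : ∀ n i, i < q → ∀ f a, s ^ q * f - x ^ i * a ^ q ∈
        T ⊔ (span {x} ⊔ span (S : Set R)) ^ n →
        ∃ b, f - x ^ i * b ^ q ∈ T ⊔ (span {x} ⊔ span (S : Set R)) ^ n by
      simpa using key n 0 hq f a
    clear f a n
    intro n
    induction n with
    | zero => simp
    | succ n ihn =>
      intro i hi f a h
      cases i with
      | zero =>
        simp only [pow_zero, one_mul] at h ⊢
        have hK := K_le _ _ _ _ h
        obtain ⟨b, hb'⟩ := IH (n + 1) s f a hs' hK
        have hab : (a - s * b) ^ q ∈ (T ⊔ span {x}) ⊔ span (S : Set R) ^ (n + 1) := by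
          have := sub_mem (Ideal.mul_mem_left _ (s ^ q) hb') hK
          convert this using 1
          rw [H]; ring
        obtain ⟨m, h1, h2⟩ : ∃ m, n + 1 ≤ q * m ∧ q * m < (n + 1) + q := by
          refine ⟨n / q + 1, ?_, ?_⟩
          · have := Nat.lt_mul_div_succ n hq
            omega
          · have := Nat.mul_div_le n q
            rw [mul_add]; omega
        obtain ⟨g', hg', a', ha'⟩ := decomp (ord hq H S _ (hT.right hx) m (n + 1) _ h1 h2 hab)
        obtain ⟨g, hg, f1, hf1⟩ := decomp hb'
        have hgK := J_le _ (span {x}) _ _ hg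
        have hgK' := pow_mem_K hq H h1 (J_le _ (span {x}) _ _ hg')
        have e : (a - s * b) ^ q = g' ^ q + x ^ q * a' ^ q := by rw [ha', Hadd, mul_pow]
        obtain ⟨r, rfl⟩ : ∃ r, q = r + 1 := ⟨q - 1, by omega⟩
        obtain ⟨c, hc⟩ := ihn r (by omega) f1 a' (colon hp n _ (by
          have := add_mem (sub_mem h (Ideal.mul_mem_left _ (s ^ (r + 1)) hgK)) hgK'
          convert this using 1
          rw [H, mul_pow] at e
          linear_combination (-s ^ (r + 1)) * hf1 + e))
        refine ⟨b + x * c, ?_⟩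
        have := add_mem hgK (x_mul_mem hc)
        convert this using 1
        rw [Hadd, mul_pow]
        linear_combination hf1
      | succ i =>
        have hK := K_le _ _ _ _ h
        have hf : s ^ q * f ∈ (T ⊔ span {x}) ⊔ span (S : Set R) ^ (n + 1) := by
          have hxm : x ^ (i + 1) * a ^ q ∈ (T ⊔ span {x}) ⊔ span (S : Set R) ^ (n + 1) := by
            refine Ideal.mem_sup_left (Ideal.mem_sup_right ?_)
            rw [pow_succ', mul_assoc]
            exact Ideal.mul_mem_right _ _ (Ideal.mem_span_singleton_self x)
          simpa using add_mem hK hxm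
        obtain ⟨g, hg, f1, rfl⟩ := decomp (prim S _ (hT.right hx) (n + 1) _ f hsq hf)
        have hgK := J_le _ (span {x}) _ _ hg
        obtain ⟨c, hc⟩ := ihn i (by omega) f1 a (colon hp n _ (by
          have := sub_mem h (Ideal.mul_mem_left _ (s ^ q) hgK)
          convert this using 1
          ring))
        refine ⟨c, ?_⟩
        have := add_mem hgK (x_mul_mem hc)
        convert this using 1
        ring

end general
end PowQ

namespace PowQ
open Ideal IsLocalRing

lemma dim_le_card {R : Type*} [CommRing R] [IsLocalRing R] [IsNoetherianRing R] (G : Finset R)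
    (hG : span (G : Set R) = maximalIdeal R) : ringKrullDim R ≤ G.card := by
  refine (ringKrullDim_le_spanFinrank_maximalIdeal R).trans ?_
  rw [← hG]
  have := Submodule.spanFinrank_span_le_ncard_of_finite (R := R) (Finset.finite_toSet G)
  rw [Set.ncard_coe_finset] at this
  exact_mod_cast this

lemma exchange {R : Type*} [CommRing R] [IsLocalRing R] [DecidableEq R] (I : Ideal R)
    (G : Finset R) (hG : maximalIdeal R = I ⊔ span (G : Set R)) (x : R) (hx : x ∈ maximalIdeal R)
    (hx2 : x ∉ I ⊔ maximalIdeal R ^ 2) :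
    ∃ y ∈ G, maximalIdeal R = I ⊔ span {x} ⊔ span ((G.erase y : Finset R) : Set R) := by
  have hx' := hx
  rw [hG] at hx'
  obtain ⟨i, hi, z, hz, hxz⟩ := Submodule.mem_sup.1 hx'
  obtain ⟨c, -, hc⟩ := Submodule.mem_span_finset.1 hz
  have hGm : ∀ g ∈ G, g ∈ maximalIdeal R := fun g hg => by
    rw [hG]; exact Ideal.mem_sup_right (Ideal.subset_span hg)
  have : ∃ y ∈ G, c y ∉ maximalIdeal R := by
    by_contra! hcon
    apply hx2
    rw [← hxz, ← hc]
    refine add_mem (Ideal.mem_sup_left hi) (Ideal.mem_sup_right (Ideal.sum_mem _ fun g hg => ?_))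
    rw [pow_two, smul_eq_mul]
    exact Ideal.mul_mem_mul (hcon g hg) (hGm g hg)
  obtain ⟨y, hy, hcy⟩ := this
  refine ⟨y, hy, le_antisymm ?_ ?_⟩
  · conv_lhs => rw [hG]
    refine sup_le (le_sup_left.trans le_sup_left) (Ideal.span_le.2 fun g hg => ?_)
    by_cases hgy : g = y
    · subst hgy
      have hu : IsUnit (c g) := by simpa using hcy
      rw [SetLike.mem_coe, ← Ideal.unit_mul_mem_iff_mem _ hu]
      have e : c g * g = x - i - ∑ a ∈ G.erase g, c a * a := by
        rw [← hxz, ← hc, ← Finset.add_sum_erase G _ hy]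
        simp only [smul_eq_mul]
        ring
      rw [e]
      refine sub_mem (sub_mem (Ideal.mem_sup_left (Ideal.mem_sup_right
        (Ideal.mem_span_singleton_self x))) (Ideal.mem_sup_left (Ideal.mem_sup_left hi)))
        (Ideal.sum_mem _ fun a ha => Ideal.mem_sup_right (Ideal.mul_mem_left _ _
          (Ideal.subset_span ha)))
    · exact Ideal.mem_sup_right (Ideal.subset_span (Finset.mem_coe.2 (Finset.mem_erase.2 ⟨hgy, hg⟩)))
  · refine sup_le (sup_le (le_sup_left.trans hG.ge) ?_) (Ideal.span_le.2 fun g hg => ?_)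
    · exact (Ideal.span_singleton_le_iff_mem _).2 hx
    · exact hGm g (Finset.mem_of_mem_erase hg)

lemma quot_span {R : Type*} [CommRing R] [IsLocalRing R] (I : Ideal R) [IsLocalRing (R ⧸ I)]
    [DecidableEq (R ⧸ I)]
    (G : Finset R) (hG : maximalIdeal R = I ⊔ span (G : Set R)) :
    span ((G.image (Ideal.Quotient.mk I) : Finset (R ⧸ I)) : Set (R ⧸ I)) =
      maximalIdeal (R ⧸ I) := by
  rw [← IsLocalRing.map_maximalIdeal_of_surjective (Ideal.Quotient.mk I)
    Ideal.Quotient.mk_surjective, hG, Ideal.map_sup, Ideal.map_quotient_self, bot_sup_eq,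
    Ideal.map_span, Finset.coe_image]

lemma local_quot {R : Type*} [CommRing R] [IsLocalRing R] {I : Ideal R}
    (hI : I ≤ maximalIdeal R) : IsLocalRing (R ⧸ I) := by
  have : Nontrivial (R ⧸ I) := Ideal.Quotient.nontrivial_iff.2
    (fun h => (maximalIdeal.isMaximal R).ne_top (top_le_iff.1 (h ▸ hI)))
  exact IsLocalRing.of_surjective' (Ideal.Quotient.mk I) Ideal.Quotient.mk_surjective

lemma H_quot {R : Type*} [CommRing R] {q : ℕ} (H : ∀ a b : R, (a - b) ^ q = a ^ q - b ^ q)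
    (I : Ideal R) : ∀ a b : R ⧸ I, (a - b) ^ q = a ^ q - b ^ q := by
  intro a b
  obtain ⟨a, rfl⟩ := Ideal.Quotient.mk_surjective a
  obtain ⟨b, rfl⟩ := Ideal.Quotient.mk_surjective b
  simp only [← map_sub, ← map_pow, H]

lemma closed_step {R : Type*} [CommRing R] [IsLocalRing R] [IsNoetherianRing R] [IsDomain R]
    {q : ℕ} (hq : 0 < q) (H : ∀ a b : R, (a - b) ^ q = a ^ q - b ^ q) (x : R) (hx : Prime x)
    (hc : ∀ a s t : R ⧸ span {x}, a ^ q = s ^ q * t → s ∣ a) :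
    ∀ a s t : R, a ^ q = s ^ q * t → s ∣ a := by
  have hxm : x ∈ maximalIdeal R := (mem_maximalIdeal x).2 hx.not_isUnit
  have main : ∀ s : R, ¬ x ∣ s → ∀ a t : R, a ^ q = s ^ q * t → s ∣ a := by
    intro s hs
    have step : ∀ N : ℕ, ∀ a t : R, a ^ q = s ^ q * t → ∃ b c, a = s * b + x ^ N * c := by
      intro N
      induction N with
      | zero => intro a t _; exact ⟨0, a, by simp⟩
      | succ N ih =>
        intro a t h
        have h1 := hc (Ideal.Quotient.mk _ a) (Ideal.Quotient.mk _ s) (Ideal.Quotient.mk _ t)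
          (by simp only [← map_pow, ← map_mul, h])
        obtain ⟨b, hb⟩ := h1
        obtain ⟨b, rfl⟩ := Ideal.Quotient.mk_surjective b
        rw [← map_mul, Ideal.Quotient.eq, Ideal.mem_span_singleton] at hb
        obtain ⟨a', ha'⟩ := hb
        have e : s ^ q * (t - b ^ q) = x ^ q * a' ^ q := by
          rw [← mul_pow, ← ha', H, h]; ring
        have hd : x ^ q ∣ t - b ^ q := by
          refine hx.pow_dvd_of_dvd_mul_left q (a := s ^ q) ?_ ⟨_, e⟩
          exact fun hh => hs (hx.dvd_of_dvd_pow hh)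
        obtain ⟨t', ht'⟩ := hd
        obtain ⟨b', c, hbc⟩ := ih a' t' (by
          rw [ht'] at e
          have hx0 : x ^ q ≠ 0 := pow_ne_zero _ hx.ne_zero
          apply mul_left_cancel₀ hx0
          rw [← e]; ring)
        refine ⟨b + x * b', c, ?_⟩
        rw [sub_eq_iff_eq_add] at ha'
        rw [ha', hbc]; ring
    intro a t h
    by_cases hsu : IsUnit s
    · exact hsu.dvd
    have hk := Ideal.iInf_pow_smul_eq_bot_of_isLocalRing (R := R) (M := R ⧸ span {s})
      (maximalIdeal R) (maximalIdeal.isMaximal R).ne_top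
    rw [← Ideal.mem_span_singleton, ← Ideal.Quotient.eq_zero_iff_mem, ← Submodule.mem_bot R, ← hk,
      Submodule.mem_iInf]
    intro N
    obtain ⟨b, c, rfl⟩ := step N a t h
    have : Ideal.Quotient.mk (span {s}) (s * b + x ^ N * c) =
        (x ^ N) • (Ideal.Quotient.mk (span {s}) c) := by
      rw [map_add, Ideal.Quotient.eq_zero_iff_mem.2 (Ideal.mul_mem_right _ _
        (Ideal.mem_span_singleton_self s)), zero_add, map_mul]
      rfl
    rw [this]
    exact Submodule.smul_mem_smul (Ideal.pow_mem_pow hxm N) trivial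
  intro a s t h
  by_cases hs : s = 0
  · subst hs
    rw [zero_pow hq.ne', zero_mul] at h
    rw [pow_eq_zero_iff hq.ne'] at h
    simp [h]
  obtain ⟨k, s', hs', rfl⟩ := WfDvdMonoid.max_power_factor hs hx.irreducible
  clear hs
  induction k generalizing a with
  | zero => simp only [pow_zero, one_mul] at h ⊢; exact main s' hs' a t h
  | succ k ih =>
    have hxa : x ∣ a := hx.dvd_of_dvd_pow (n := q) (by
      rw [h, pow_succ', mul_assoc, mul_pow, mul_assoc]
      exact (dvd_pow_self x hq.ne').mul_right _)
    obtain ⟨a, rfl⟩ := hxa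
    rw [pow_succ', mul_assoc]
    refine mul_dvd_mul_left x (ih a ?_)
    apply mul_left_cancel₀ (pow_ne_zero q hx.ne_zero)
    rw [← mul_pow, h]; ring

lemma dom {q : ℕ} (hq : 0 < q) (d : ℕ) : ∀ (R : Type*) [CommRing R] [IsLocalRing R]
    [IsNoetherianRing R], (∀ a b : R, (a - b) ^ q = a ^ q - b ^ q) → ∀ (G : Finset R),
    span (G : Set R) = maximalIdeal R → G.card ≤ d → (d : WithBot ℕ∞) ≤ ringKrullDim R →
    IsDomain R ∧ ∀ a s t : R, a ^ q = s ^ q * t → s ∣ a := by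
  classical
  induction d with
  | zero =>
    intro R _ _ _ H G hG hd _
    have : G = ∅ := by simpa using hd
    subst this
    have hm : maximalIdeal R = ⊥ := by rw [← hG]; simp
    have hf : IsField R := IsLocalRing.isField_iff_maximalIdeal_eq.2 hm
    letI := hf.toField
    refine ⟨inferInstance, fun a s t h => ?_⟩
    by_cases hs : s = 0
    · subst hs
      rw [zero_pow hq.ne', zero_mul] at h
      rw [pow_eq_zero_iff hq.ne'] at h
      simp [h]
    · exact (IsUnit.mk0 s hs).dvd
  | succ d ih =>
    intro R _ _ _ H G hG hd hdim
    have hpos : ¬ (ringKrullDim R ≤ 0) := fun h0 => by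
      have := hdim.trans h0
      norm_cast at this
    have hmin : maximalIdeal R ∉ minimalPrimes R := fun h => by
      apply hpos
      rw [← maximalIdeal_height_eq_ringKrullDim, Ideal.height_eq_zero_iff.2 h]
      rfl
    have hav : ¬ ((maximalIdeal R : Set R) ⊆
        ⋃ i ∈ insert (maximalIdeal R ^ 2) (minimalPrimes R), (id i : Ideal R)) := by
      rw [Ideal.subset_union_prime_finite ((minimalPrimes.finite_of_isNoetherianRing R).insert _)
        (maximalIdeal R ^ 2) (maximalIdeal R ^ 2)]
      · rintro ⟨i, hi, hle⟩
        rcases hi with rfl | hi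
        · have hb : maximalIdeal R = ⊥ := by
            refine Submodule.eq_bot_of_le_smul_of_le_jacobson_bot (maximalIdeal R) _
              (IsNoetherian.noetherian _) ?_ ?_
            · rw [smul_eq_mul, ← pow_two]; exact hle
            · exact IsLocalRing.maximalIdeal_le_jacobson _
          have hf : IsField R := IsLocalRing.isField_iff_maximalIdeal_eq.2 hb
          exact hpos (ringKrullDim_eq_zero_of_isField hf).le
        · have := hi.1.1
          have e := (maximalIdeal.isMaximal R).eq_of_le this.ne_top hle
          exact hmin (by rw [e]; exact hi)
      · intro i hi h1 _
        exact (hi.resolve_left h1).1.1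
    rw [Set.not_subset] at hav
    obtain ⟨x, hxm, hx⟩ := hav
    simp only [id, Set.mem_iUnion, not_exists] at hx
    have hx2 : x ∉ (⊥ : Ideal R) ⊔ maximalIdeal R ^ 2 := by
      rw [bot_sup_eq]; exact hx _ (Set.mem_insert _ _)
    have hxp : ∀ p ∈ minimalPrimes R, x ∉ p := fun p hp => hx p (Set.mem_insert_of_mem _ hp)
    obtain ⟨y, hy, hm⟩ := exchange ⊥ G (by rw [bot_sup_eq, hG]) x hxm hx2
    rw [bot_sup_eq] at hm
    haveI := local_quot (I := span {x}) ((Ideal.span_singleton_le_iff_mem _).2 hxm)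
    have hdim' : (d : WithBot ℕ∞) ≤ ringKrullDim (R ⧸ span {x}) := by
      rw [← ENat.WithBot.add_le_add_one_right_iff]
      have h1 := ringKrullDim_le_ringKrullDim_quotient_add_card {x} (by
        rw [IsLocalRing.ringJacobson_eq_maximalIdeal]; simpa using hxm)
      rw [Finset.coe_singleton, Finset.card_singleton] at h1
      exact_mod_cast hdim.trans h1
    obtain ⟨hD, hC⟩ := ih (R ⧸ span {x}) (H_quot H _) _ (quot_span _ _ hm)
      (Finset.card_image_le.trans (by rw [Finset.card_erase_of_mem hy]; omega)) hdim'
    have hxpr : (span {x}).IsPrime := (Ideal.Quotient.isDomain_iff_prime _).1 hD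
    obtain ⟨p, hp, hpx⟩ := Ideal.exists_minimalPrimes_le (I := (⊥ : Ideal R)) (J := span {x}) bot_le
    have hxp' := hxp p hp
    have hppr := hp.1.1
    have hpb : p = ⊥ := by
      refine Submodule.eq_bot_of_le_smul_of_le_jacobson_bot (maximalIdeal R) _
        (IsNoetherian.noetherian _) ?_ (IsLocalRing.maximalIdeal_le_jacobson _)
      intro z hz
      obtain ⟨k, rfl⟩ := Ideal.mem_span_singleton.1 (hpx hz)
      exact Ideal.mul_mem_mul hxm ((hppr.mem_or_mem hz).resolve_left hxp')
    subst hpb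
    haveI : IsDomain R := IsDomain.of_bot_isPrime R
    have hx0 : x ≠ 0 := fun h => hxp' (by simp [h])
    exact ⟨this, closed_step hq H x ((Ideal.span_singleton_prime hx0).1 hxpr) hC⟩

lemma dom_quot {q : ℕ} (hq : 0 < q) {R : Type*} [CommRing R] [IsLocalRing R]
    [IsNoetherianRing R] (H : ∀ a b : R, (a - b) ^ q = a ^ q - b ^ q) (I : Ideal R) (G : Finset R)
    (hG : maximalIdeal R = I ⊔ span (G : Set R))
    (hd : (G.card : WithBot ℕ∞) ≤ ringKrullDim (R ⧸ I)) : I.IsPrime := by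
  classical
  haveI := local_quot (I := I) (le_sup_left.trans hG.ge)
  exact (Ideal.Quotient.isDomain_iff_prime _).1 (dom hq G.card (R ⧸ I) (H_quot H _) _
    (quot_span _ _ hG) Finset.card_image_le hd).1

lemma exists_S {R : Type*} [CommRing R] [IsLocalRing R] [DecidableEq R] (P : Ideal R)
    (hP : P ≤ maximalIdeal R) (k : ℕ) : ∀ S G : Finset R, (S : Set R) ⊆ P →
    maximalIdeal R = span (S : Set R) ⊔ span (G : Set R) → G.card ≤ k →
    ∃ S' G' : Finset R, (S' : Set R) ⊆ P ∧
    maximalIdeal R = span (S' : Set R) ⊔ span (G' : Set R) ∧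
    S'.card + G'.card ≤ S.card + G.card ∧ P ≤ span (S' : Set R) ⊔ maximalIdeal R ^ 2 := by
  induction k with
  | zero =>
    intro S G hS hG hk
    refine ⟨S, G, hS, hG, le_rfl, ?_⟩
    have : G = ∅ := by simpa using hk
    subst this
    rw [Finset.coe_empty, Ideal.span_empty, sup_bot_eq] at hG
    exact hP.trans (hG.le.trans le_sup_left)
  | succ k ih =>
    intro S G hS hG hk
    by_cases h : P ≤ span (S : Set R) ⊔ maximalIdeal R ^ 2
    · exact ⟨S, G, hS, hG, le_rfl, h⟩
    · obtain ⟨x, hxP, hx⟩ := SetLike.not_le_iff_exists.1 h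
      obtain ⟨y, hy, hm⟩ := exchange _ G hG x (hP hxP) hx
      have hc := Finset.card_erase_of_mem hy
      have hc0 : 0 < G.card := Finset.card_pos.2 ⟨y, hy⟩
      obtain ⟨S', G', h1, h2, h3, h4⟩ := ih (insert x S) (G.erase y) (by
        rw [Finset.coe_insert]; exact Set.insert_subset hxP hS) (by
        rw [Finset.coe_insert, Ideal.span_insert, sup_comm (span {x}), ← hm]) (by omega)
      refine ⟨S', G', h1, h2, ?_, h4⟩
      have := Finset.card_insert_le x S
      omega

lemma good_of {q : ℕ} (hq : 0 < q) {R : Type*} [CommRing R] [IsLocalRing R]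
    [IsNoetherianRing R] [DecidableEq R] (H : ∀ a b : R, (a - b) ^ q = a ^ q - b ^ q)
    (W : Finset R) (hW : span (W : Set R) = maximalIdeal R)
    (hd : (W.card : WithBot ℕ∞) ≤ ringKrullDim R) : Good (⊥ : Ideal R) W := by
  intro U hU
  rw [bot_sup_eq]
  constructor
  · refine dom_quot hq H _ (W \ U) ?_ ?_
    · rw [← Ideal.span_union, ← Finset.coe_union, Finset.union_sdiff_of_subset hU, hW]
    · rw [← ENat.WithBot.add_le_add_natCast_right_iff (c := U.card)]
      have h1 := ringKrullDim_le_ringKrullDim_quotient_add_card U (by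
        rw [IsLocalRing.ringJacobson_eq_maximalIdeal, ← hW]
        exact (Finset.coe_subset.2 hU).trans Ideal.subset_span)
      refine le_trans ?_ (hd.trans h1)
      have := Finset.card_sdiff_add_card_eq_card hU
      exact_mod_cast this.le
  · intro x hx hxU hxs
    have : span ((W.erase x : Finset R) : Set R) = maximalIdeal R := by
      rw [← hW]
      refine le_antisymm (Ideal.span_mono (Finset.coe_subset.2 (Finset.erase_subset _ _)))
        (Ideal.span_le.2 fun g hg => ?_)
      by_cases hgx : g = x
      · subst hgx
        refine Ideal.span_mono ?_ hxs
        intro u hu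
        exact Finset.mem_coe.2 (Finset.mem_erase.2 ⟨fun h => hxU (h ▸ hu), hU hu⟩)
      · exact Ideal.subset_span (Finset.mem_coe.2 (Finset.mem_erase.2 ⟨hgx, hg⟩))
    have h1 := hd.trans (dim_le_card _ this)
    rw [Finset.card_erase_of_mem hx] at h1
    have h2 : W.card ≤ W.card - 1 := by exact_mod_cast h1
    have := Finset.card_pos.2 ⟨x, hx⟩
    omega

lemma exists_good {q : ℕ} (hq : 0 < q) {R : Type*} [CommRing R] [IsLocalRing R]
    [IsNoetherianRing R] [DecidableEq R] (H : ∀ a b : R, (a - b) ^ q = a ^ q - b ^ q)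
    (G : Finset R) (hG : span (G : Set R) = maximalIdeal R)
    (hd : (G.card : WithBot ℕ∞) ≤ ringKrullDim R) (P : Ideal R) [P.IsPrime] [IsLocalRing (R ⧸ P)]
    (K : Finset (R ⧸ P)) (hK : span (K : Set (R ⧸ P)) = maximalIdeal (R ⧸ P))
    (hdK : (K.card : WithBot ℕ∞) ≤ ringKrullDim (R ⧸ P)) :
    ∃ S : Finset R, span (S : Set R) = P ∧ Good (⊥ : Ideal R) S := by
  classical
  have hPm : P ≤ maximalIdeal R := IsLocalRing.le_maximalIdeal Ideal.IsPrime.ne_top'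
  obtain ⟨S, F, hS, hF, hcard, hPS⟩ := exists_S P hPm G.card ∅ G (by simp) (by simp [hG]) le_rfl
  rw [Finset.card_empty, zero_add] at hcard
  have hdle : ∀ V : Finset R, span (V : Set R) = maximalIdeal R → G.card ≤ V.card := fun V hV => by
    exact_mod_cast hd.trans (dim_le_card V hV)
  have hgood : Good (⊥ : Ideal R) (S ∪ F) := by
    refine good_of hq H _ (by rw [Finset.coe_union, Ideal.span_union, hF]) (le_trans ?_ hd)
    exact_mod_cast (Finset.card_union_le S F).trans hcard
  refine ⟨S, ?_, fun U hU => ⟨(hgood U (hU.trans Finset.subset_union_left)).1, fun x hx =>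
    (hgood U (hU.trans Finset.subset_union_left)).2 x (Finset.mem_union_left _ hx)⟩⟩
  have hSp : (span (S : Set R)).IsPrime := by
    simpa using (hgood S Finset.subset_union_left).1
  have hSP : span (S : Set R) ≤ P := Ideal.span_le.2 hS
  -- lift the generators
  obtain ⟨L, hL, hLc⟩ : ∃ L : Finset R, L.image (Ideal.Quotient.mk P) = K ∧ L.card ≤ K.card := by
    refine ⟨K.image (Function.surjInv Ideal.Quotient.mk_surjective), ?_, Finset.card_image_le⟩
    rw [Finset.image_image]
    ext z
    simp [Function.surjInv_eq]
  have hmL : maximalIdeal R = P ⊔ span (L : Set R) := by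
    have h1 : (span (L : Set R)).map (Ideal.Quotient.mk P) = maximalIdeal (R ⧸ P) := by
      rw [Ideal.map_span, ← Finset.coe_image, hL, hK]
    haveI := IsLocalHom.of_surjective (Ideal.Quotient.mk P) Ideal.Quotient.mk_surjective
    rw [← IsLocalRing.maximalIdeal_comap (Ideal.Quotient.mk P), ← h1,
      Ideal.comap_map_of_surjective _ Ideal.Quotient.mk_surjective, sup_comm]
    congr 1
    change RingHom.ker (Ideal.Quotient.mk P) = P
    exact Ideal.mk_ker
  have hmSL : maximalIdeal R = span ((S ∪ L : Finset R) : Set R) := by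
    rw [Finset.coe_union, Ideal.span_union]
    refine le_antisymm ?_ (sup_le (hSP.trans hPm) (le_sup_right.trans hmL.ge))
    refine Submodule.le_of_le_smul_of_le_jacobson_bot (I := maximalIdeal R)
      (IsNoetherian.noetherian _) (IsLocalRing.maximalIdeal_le_jacobson _) ?_
    rw [smul_eq_mul, ← pow_two]
    calc maximalIdeal R = P ⊔ span (L : Set R) := hmL
      _ ≤ (span (S : Set R) ⊔ maximalIdeal R ^ 2) ⊔ span (L : Set R) := sup_le_sup_right hPS _
      _ = _ := by rw [sup_right_comm]
  have hc1 := (hdle _ hmSL.symm).trans (Finset.card_union_le S L)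
  have hFK : F.card ≤ K.card := by omega
  refine le_antisymm hSP ?_
  by_contra hne
  obtain ⟨y, hyP, hyS⟩ := SetLike.not_le_iff_exists.1 hne
  haveI : IsDomain (R ⧸ span (S : Set R)) := (Ideal.Quotient.isDomain_iff_prime _).2 hSp
  haveI := local_quot (I := span (S : Set R)) (hSP.trans hPm)
  have h1 := ringKrullDim_succ_le_of_surjective (Ideal.Quotient.factor hSP)
    (Ideal.Quotient.factor_surjective hSP) (r := Ideal.Quotient.mk _ y)
    (mem_nonZeroDivisors_of_ne_zero (fun h => hyS (Ideal.Quotient.eq_zero_iff_mem.1 h)))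
    (by rw [Ideal.Quotient.factor_mk]; exact Ideal.Quotient.eq_zero_iff_mem.2 hyP)
  have h2 := dim_le_card _ (quot_span (span (S : Set R)) F hF)
  have h3 : ringKrullDim (R ⧸ P) + 1 ≤ (K.card : ℕ) := by
    refine h1.trans (h2.trans ?_)
    exact_mod_cast Finset.card_image_le.trans hFK
  rw [ENat.WithBot.add_one_le_natCast_iff] at h3
  exact absurd hdK (not_le.2 h3)

lemma of_reg {R : Type*} [CommRing R] [IsLocalRing R] (h : IsRegularLocal R) :
    ∃ G : Finset R, span (G : Set R) = maximalIdeal R ∧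
      (G.card : WithBot ℕ∞) ≤ ringKrullDim R := by
  classical
  obtain ⟨hN, rs, hreg, hspan⟩ := h
  refine ⟨rs.toFinset, by rw [← hspan]; congr 1; ext; simp, ?_⟩
  rw [← ringKrullDim_add_length_eq_ringKrullDim_of_isRegular rs hreg]
  have : Nontrivial (R ⧸ Ideal.ofList rs) := Ideal.Quotient.nontrivial_iff.2 (by
    rw [Ideal.ofList, hspan]; exact (maximalIdeal.isMaximal R).ne_top)
  calc ((rs.toFinset.card : ℕ) : WithBot ℕ∞) ≤ (rs.length : ℕ) := by
        exact_mod_cast List.toFinset_card_le rs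
    _ = 0 + (rs.length : ℕ) := (zero_add _).symm
    _ ≤ _ := by
      gcongr
      exact ringKrullDim_nonneg_of_nontrivial

end PowQ


/-- For an `F`-finite regular local ring `R` of characteristic `p > 0`, `q = p ^ e`, and a
prime `P ⊂ R` with regular quotient `R / P`:  `R^q + P^n = (R_P^q + P^n R_P) ∩ R`. -/
theorem powQ_add_pow_prime_eq_contraction
    (R : Type*) [CommRing R] [IsDomain R] [IsLocalRing R] (hreg : IsRegularLocal R)
    (p : ℕ) [Fact p.Prime] [CharP R p]
    (hF : Module.Finite (↥(frobenius R p).range) R)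
    (e q : ℕ) (hq : q = p ^ e)
    (P : Ideal R) [P.IsPrime] [IsLocalRing (R ⧸ P)]
    (hPreg : IsRegularLocal (R ⧸ P)) (n : ℕ) (f : R) :
    (∃ lam : R, f - lam ^ q ∈ P ^ n) ↔
      ∃ μ : Localization.AtPrime P,
        algebraMap R (Localization.AtPrime P) f - μ ^ q ∈
          (P.map (algebraMap R (Localization.AtPrime P))) ^ n := by
  classical
  constructor
  · rintro ⟨l, hl⟩
    refine ⟨algebraMap R _ l, ?_⟩
    rw [← map_pow, ← map_sub, ← Ideal.map_pow]
    exact Ideal.mem_map_of_mem _ hl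
  rintro ⟨μ, hμ⟩
  have hq0 : 0 < q := hq ▸ pow_pos (Fact.out : p.Prime).pos e
  have H : ∀ a b : R, (a - b) ^ q = a ^ q - b ^ q := fun a b => by
    rw [hq, sub_pow_char_pow]
  haveI := hreg.1
  obtain ⟨G, hG, hGd⟩ := PowQ.of_reg hreg
  obtain ⟨K, hK, hKd⟩ := PowQ.of_reg hPreg
  obtain ⟨S, hS, hgood⟩ := PowQ.exists_good hq0 H G hG hGd P K hK hKd
  haveI := hPreg.1
  have hclosed := (PowQ.dom hq0 K.card (R ⧸ P) (PowQ.H_quot H P) K hK le_rfl hKd).2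
  have hprim := PowQ.prim S ⊥ hgood
  have hmain := PowQ.main hq0 H S ⊥ hgood
  simp only [bot_sup_eq, hS] at hprim hmain
  obtain ⟨⟨a, s⟩, hs⟩ := IsLocalization.surj P.primeCompl μ
  simp only at hs
  have hsP : (s : R) ∉ P := s.2
  have h1 : algebraMap R (Localization.AtPrime P) ((s : R) ^ q * f - a ^ q) ∈
      (P ^ n).map (algebraMap R (Localization.AtPrime P)) := by
    rw [Ideal.map_pow]
    have := Ideal.mul_mem_left _ (algebraMap R (Localization.AtPrime P) s ^ q) hμ
    convert this using 1
    rw [map_sub, map_mul, map_pow, map_pow, ← hs]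
    ring
  rw [IsLocalization.algebraMap_mem_map_algebraMap_iff P.primeCompl] at h1
  obtain ⟨u, hu, hu'⟩ := h1
  have h2 := hprim n u _ hu hu'
  refine hmain ?_ n s f a hsP h2
  intro s f a hs h
  have h3 : (Ideal.Quotient.mk P a) ^ q = (Ideal.Quotient.mk P s) ^ q * Ideal.Quotient.mk P f := by
    rw [← map_pow, ← map_pow, ← map_mul]
    exact ((Ideal.Quotient.eq).2 h).symm
  obtain ⟨b, hb⟩ := hclosed _ _ _ h3
  obtain ⟨b, rfl⟩ := Ideal.Quotient.mk_surjective b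
  refine ⟨b, ?_⟩
  rw [hb, mul_pow] at h3
  have hs0 : (Ideal.Quotient.mk P s) ^ q ≠ 0 :=
    pow_ne_zero _ (fun h => hs (Ideal.Quotient.eq_zero_iff_mem.1 h))
  have h4 := mul_left_cancel₀ hs0 h3
  rw [← map_pow] at h4
  exact Ideal.Quotient.eq.1 h4.symm
end

section
/- Let (R, m) be an F-finite regular local ring of characteristic p > 0 and q = p^e. For f ∈ R and n ≥ 1: f ∈ m^n if and only if D(f) ∈ m for every differential operator D of R of order at most n − 1. -/
/-- `IsDiffOp R n D` : `D` is an (absolute) differential operator of `R` of order at most `n`,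
defined inductively: order `≤ 0` means `R`-linear, and `D` has order `≤ n+1` if all the
commutators `[D, mulLeft r]` have order `≤ n`.  (For commutative rings this agrees with the
definition via the left `R`-linear extension of `D` to `R ⊗ R` annihilating `T_R^{n+1}`.) -/
def IsDiffOp (R : Type*) [CommRing R] : ℕ → (R →+ R) → Prop
  | 0, D => ∀ r s : R, D (r * s) = r * D s
  | n + 1, D => ∀ r : R,
      IsDiffOp R n ((D.comp (AddMonoidHom.mulLeft r)) - ((AddMonoidHom.mulLeft r).comp D))


theorem qr_artinRees {R M₁ M₂ : Type*} [CommRing R] [IsNoetherianRing R] [AddCommGroup M₁]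
    [Module R M₁] [AddCommGroup M₂] [Module R M₂] [Module.Finite R M₂] (I : Ideal R)
    (f : M₁ →ₗ[R] M₂) (s : ℕ) :
    ∃ N, s ≤ N ∧ ∀ w, f w ∈ (I ^ N • ⊤ : Submodule R M₂) →
      ∃ w' ∈ (I ^ s • ⊤ : Submodule R M₁), f w' = f w := by
  obtain ⟨k, hk⟩ := Ideal.exists_pow_inf_eq_pow_smul I (LinearMap.range f)
  refine ⟨k + s, by omega, fun w hw => ?_⟩
  have h1 : f w ∈ (I ^ (k + s) • ⊤ ⊓ LinearMap.range f : Submodule R M₂) := ⟨hw, w, rfl⟩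
  rw [hk _ (by omega)] at h1
  have h2 : f w ∈ (I ^ s • LinearMap.range f : Submodule R M₂) := by
    have := Submodule.smul_mono (le_refl (I ^ (k + s - k)))
      (inf_le_right : (I ^ k • ⊤ ⊓ LinearMap.range f : Submodule R M₂) ≤ _) h1
    simpa using this
  rw [LinearMap.range_eq_map, ← Submodule.map_smul''] at h2
  exact h2

theorem qr_artinRees' {R : Type*} [CommRing R] [IsNoetherianRing R] (A I : Ideal R) (r : R) (s : ℕ) :
    ∃ N, ∀ w, r * w ∈ I ^ N ⊔ A → ∃ w' ∈ I ^ s, r * w - r * w' ∈ A := by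
  obtain ⟨N, -, hN⟩ := qr_artinRees I ((Submodule.mkQ A).comp (LinearMap.mulLeft R r)) s
  refine ⟨N, fun w hw => ?_⟩
  obtain ⟨w', hw', h⟩ := hN w (by
    obtain ⟨a, ha, b, hb, hab⟩ := Submodule.mem_sup.1 hw
    have : (Submodule.mkQ A).comp (LinearMap.mulLeft R r) w = a • Submodule.mkQ A 1 := by
      rw [← map_smul, LinearMap.comp_apply, ← sub_eq_zero, ← map_sub]
      simp only [LinearMap.mulLeft_apply, smul_eq_mul, mul_one, ← hab, add_sub_cancel_left]
      exact (Submodule.Quotient.mk_eq_zero A).2 hb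
    rw [this]
    exact Submodule.smul_mem_smul ha trivial)
  refine ⟨w', by simpa using hw', ?_⟩
  rw [eq_comm, ← sub_eq_zero, ← map_sub] at h
  simpa [mul_sub, Ideal.Quotient.eq_zero_iff_mem, -map_sub] using h

/-- weakly regular sequence modulo an ideal -/
def WReg {R : Type*} [CommRing R] : (d : ℕ) → (Fin d → R) → Ideal R → Prop
  | 0, _, _ => True
  | d + 1, x, A => (∀ y, x 0 * y ∈ A → y ∈ A) ∧ WReg d (Fin.tail x) (A ⊔ Ideal.span {x 0})

theorem eval_mem_of_coeff {R ι : Type*} [CommRing R] (x : ι → R) (I K : Ideal R)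
    (hx : ∀ i, x i ∈ I) (s : ℕ) (F : MvPolynomial ι R) (hF : F.IsHomogeneous s)
    (h : ∀ a, F.coeff a ∈ K) : MvPolynomial.eval x F ∈ K * I ^ s := by
  rw [MvPolynomial.eval_eq]
  refine Ideal.sum_mem _ fun a ha => Ideal.mul_mem_mul (h a) ?_
  have : a.degree = s := by
    by_contra hne
    exact (MvPolynomial.mem_support_iff.1 ha) (hF.coeff_eq_zero hne)
  rw [← this, Finsupp.degree_apply, ← Finset.prod_pow_eq_pow_sum]
  exact Ideal.prod_mem_prod fun i _ => Ideal.pow_mem_pow (hx i) _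

theorem sup_pow_le_aux {R : Type*} [CommRing R] (r : R) (J : Ideal R) (s : ℕ) :
    (Ideal.span {r} ⊔ J) ^ (s + 1) ≤ Ideal.span {r} * (Ideal.span {r} ⊔ J) ^ s ⊔ J ^ (s + 1) := by
  induction s with
  | zero => simp
  | succ s ih =>
    calc (Ideal.span {r} ⊔ J) ^ (s + 1 + 1)
        = (Ideal.span {r} ⊔ J) * (Ideal.span {r} ⊔ J) ^ (s + 1) := pow_succ' _ _
      _ = Ideal.span {r} * (Ideal.span {r} ⊔ J) ^ (s + 1) ⊔ J * (Ideal.span {r} ⊔ J) ^ (s + 1) :=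
          Ideal.sup_mul _ _ _
      _ ≤ _ := by
          refine sup_le le_sup_left ?_
          refine (Ideal.mul_mono_right ih).trans ?_
          rw [Ideal.mul_sup]
          refine sup_le (le_sup_of_le_left ?_) (le_sup_of_le_right ?_)
          · rw [← mul_assoc, mul_comm J, mul_assoc]
            refine Ideal.mul_mono_right ?_
            rw [pow_succ' _ s]
            exact Ideal.mul_mono_left le_sup_right
          · rw [← pow_succ']

set_option maxHeartbeats 1600000 in
open MvPolynomial in
theorem quasiRegular {R : Type*} [CommRing R] [IsNoetherianRing R] (d : ℕ) :
    ∀ (x : Fin d → R) (A : Ideal R), WReg d x A → ∀ (s : ℕ) (F : MvPolynomial (Fin d) R),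
      F.IsHomogeneous s → eval x F ∈ Ideal.span (Set.range x) ^ (s + 1) ⊔ A →
      ∀ a, coeff a F ∈ Ideal.span (Set.range x) ⊔ A := by
  induction d with
  | zero =>
    intro x A _ s F hF h a
    have hI : Ideal.span (Set.range x) = ⊥ := by
      rw [Set.range_eq_empty, Ideal.span_empty]
    rw [hI] at h ⊢
    by_cases hs : s = 0
    · obtain rfl : a = 0 := Subsingleton.elim _ _
      rw [eq_C_of_isEmpty F] at h
      simpa [hs] using h
    · rw [hF.coeff_eq_zero]
      · exact zero_mem _
      · obtain rfl : a = 0 := Subsingleton.elim _ _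
        simpa using Ne.symm hs
  | succ d ih =>
    intro x A hx
    obtain ⟨hreg, hx'⟩ := hx
    have ih := ih _ _ hx'
    set r := x 0 with hr
    set I' := Ideal.span (Set.range (Fin.tail x)) with hI'
    have hI : Ideal.span (Set.range x) = Ideal.span {r} ⊔ I' := by
      rw [hI', ← Ideal.span_union]
      congr 1
      conv_lhs => rw [← Fin.cons_self_tail x, Fin.range_cons]
      rfl
    rw [hI]
    set I := Ideal.span {r} ⊔ I' with hII
    have hxI : ∀ i, Fin.tail x i ∈ I := fun i =>
      (le_sup_right : I' ≤ I) (Ideal.subset_span ⟨i, rfl⟩)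
    have hrI : r ∈ I := (le_sup_left : _ ≤ I) (Ideal.mem_span_singleton_self r)
    have hIA : I' ⊔ (A ⊔ Ideal.span {r}) = I ⊔ A := by
      rw [hII, sup_comm (Ideal.span {r}), sup_assoc, sup_comm A]
    have hmul : ∀ s, (I ⊔ A) * I ^ s ≤ I ^ (s + 1) ⊔ A := fun s => by
      rw [Ideal.sup_mul, ← pow_succ']
      exact sup_le_sup_left Ideal.mul_le_left _
    have hpow : ∀ s, I ^ (s + 1) ⊔ A ≤ I' ^ (s + 1) ⊔ (A ⊔ Ideal.span {r}) := fun s => by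
      refine sup_le ((sup_pow_le_aux r I' s).trans (sup_le ?_ le_sup_left)) ?_
      · exact Ideal.mul_le_left.trans (le_sup_of_le_right le_sup_right)
      · exact le_sup_of_le_right le_sup_left
    -- Lemma 0
    have key : ∀ s (G : MvPolynomial (Fin d) R), G.IsHomogeneous s →
        eval (Fin.tail x) G ∈ I ^ (s + 1) ⊔ A ⊔ Ideal.span {r} → (∀ a, coeff a G ∈ I ⊔ A) := by
      intro s G hG h
      rw [← hIA]
      refine ih s G hG ?_
      refine (sup_le (hpow s) ?_ : I ^ (s + 1) ⊔ A ⊔ Ideal.span {r} ≤ _) h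
      exact le_sup_of_le_right le_sup_right
    have lem2 : ∀ s y, r * y ∈ I ^ (s + 1) ⊔ A → ∃ P ∈ I ^ s, r * (y - P) ∈ I ^ (s + 2) ⊔ A := by
      intro s y hy
      obtain ⟨u, hu, b, hb, hub⟩ := Submodule.mem_sup.1 hy
      obtain ⟨v, hv, z, hz, hvz⟩ := Submodule.mem_sup.1 (sup_pow_le_aux r I' s hu)
      obtain ⟨P, hP, rfl⟩ := Ideal.mem_span_singleton_mul.1 hv
      refine ⟨P, hP, ?_⟩
      obtain ⟨G, hG, hGz⟩ := (Ideal.mem_span_pow_iff_exists_isHomogeneous _ _).1 hz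
      have hz' : z = r * (y - P) - b := by rw [mul_sub, ← hub, ← hvz]; ring
      have h1 := key (s + 1) G hG (by
        rw [hGz, hz', sub_eq_add_neg]
        exact Ideal.add_mem _ (Ideal.mem_sup_right (Ideal.mul_mem_right _ _
            (Ideal.mem_span_singleton_self r)))
          (Ideal.mem_sup_left (Ideal.mem_sup_right (neg_mem hb))))
      have h2 := hmul _ (eval_mem_of_coeff _ I _ hxI _ G hG h1)
      rw [hGz] at h2
      have : r * (y - P) = z + b := by rw [hz']; ring
      rw [this]
      exact Ideal.add_mem _ h2 (Ideal.mem_sup_right hb)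
    have lem3 : ∀ s y, r * y ∈ I ^ (s + 1) ⊔ A → y ∈ I ^ s ⊔ A := by
      intro s y hy
      have hit : ∀ N, ∃ P ∈ I ^ s, r * (y - P) ∈ I ^ (s + N + 1) ⊔ A := by
        intro N
        induction N with
        | zero => exact ⟨0, zero_mem _, by simpa using hy⟩
        | succ N ihN =>
          obtain ⟨P, hP, h⟩ := ihN
          obtain ⟨P', hP', h'⟩ := lem2 _ _ h
          refine ⟨P + P', add_mem hP (Ideal.pow_le_pow_right (by omega) hP'), ?_⟩
          rw [← sub_sub]
          exact h'
      obtain ⟨N, hN⟩ := qr_artinRees' A I r s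
      obtain ⟨P, hP, h⟩ := hit N
      obtain ⟨w, hw, h'⟩ := hN _ ((sup_le_sup_right (Ideal.pow_le_pow_right (by omega)) A) h)
      rw [← mul_sub] at h'
      have h4 := hreg _ h'
      have : y = (P + w) + (y - P - w) := by ring
      rw [this]
      exact add_mem (Ideal.mem_sup_left (add_mem hP hw)) (Ideal.mem_sup_right h4)
    intro s
    induction s with
    | zero =>
      intro F hF h a
      by_cases ha : a.degree = 0
      · obtain ⟨c, hc⟩ : ∃ c, F = C c := ⟨_, (totalDegree_eq_zero_iff_eq_C.1
          (Nat.le_zero.1 hF.totalDegree_le))⟩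
        rw [Finsupp.degree_eq_zero_iff] at ha
        rw [hc] at h ⊢
        simpa [ha] using h
      · rw [hF.coeff_eq_zero ha]; exact zero_mem _
    | succ s ihs =>
      intro F hF h
      set p := finSuccEquiv R d F with hp
      set H := (finSuccEquiv R d).symm p.divX with hH
      have hcH : ∀ i m, coeff (Finsupp.cons i m) H = coeff (Finsupp.cons (i + 1) m) F := by
        intro i m
        rw [← finSuccEquiv_coeff_coeff, ← finSuccEquiv_coeff_coeff, hH, AlgEquiv.apply_symm_apply,
          Polynomial.coeff_divX]
      have hHhom : H.IsHomogeneous s := by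
        intro a ha
        rw [← Finsupp.cons_tail a, hcH] at ha
        have : (Finsupp.cons (a 0 + 1) a.tail).degree = s + 1 := by
          by_contra hne
          exact ha (hF.coeff_eq_zero hne)
        refine (DFunLike.congr_fun (Finsupp.degree_eq_weight_one (R := ℕ)) a).symm.trans ?_
        rw [← Finsupp.cons_tail a]
        simp only [Finsupp.degree_eq_sum, Pi.one_apply, Fin.sum_univ_succ, Finsupp.cons_zero,
          Finsupp.cons_succ] at this ⊢
        omega
      have heval : eval x F = r * eval x H + eval (Fin.tail x) (p.coeff 0) := by
        conv_lhs => rw [← Fin.cons_self_tail x]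
        conv_rhs => rw [← Fin.cons_self_tail x]
        rw [eval_eq_eval_mv_eval', eval_eq_eval_mv_eval', hH, AlgEquiv.apply_symm_apply, ← hp]
        have hd := congrArg (fun q => Polynomial.eval (x 0) (Polynomial.map (eval (Fin.tail x)) q))
          (Polynomial.divX_mul_X_add p)
        simp only [Polynomial.map_add, Polynomial.map_mul, Polynomial.map_X, Polynomial.map_C,
          Polynomial.eval_add, Polynomial.eval_mul, Polynomial.eval_X, Polynomial.eval_C] at hd
        rw [← hd, mul_comm]
        rfl
      have h0hom := hF.finSuccEquiv_coeff_isHomogeneous 0 (s + 1) (by omega)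
      have h0 := key _ _ h0hom (by
        have : eval (Fin.tail x) (p.coeff 0) = eval x F + r * (- eval x H) := by
          rw [heval]; ring
        rw [← hp, this]
        exact add_mem (Ideal.mem_sup_left h) (Ideal.mem_sup_right (Ideal.mul_mem_right _ _
            (Ideal.mem_span_singleton_self r))))
      have h1 := hmul _ (eval_mem_of_coeff _ I _ hxI _ _ h0hom h0)
      have h2 := lem3 _ (eval x H) (by
        have : r * eval x H = eval x F - eval (Fin.tail x) (p.coeff 0) := by rw [heval]; ring
        rw [this]
        exact sub_mem h h1)
      have h3 := ihs H hHhom h2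
      intro a
      rw [← Finsupp.cons_tail a]
      rcases hq : a 0 with _ | i
      · rw [← finSuccEquiv_coeff_coeff]
        exact h0 _
      · rw [← hcH]; exact h3 _

theorem wreg_of_list {R : Type*} [CommRing R] (rs : List R) (A : Ideal R)
    (h : ∀ i (h : i < rs.length) y, rs[i] * y ∈ A ⊔ Ideal.ofList (rs.take i) →
      y ∈ A ⊔ Ideal.ofList (rs.take i)) : WReg rs.length rs.get A := by
  induction rs generalizing A with
  | nil => trivial
  | cons r rs ih =>
    refine ⟨fun y hy => ?_, ?_⟩
    · have := h 0 (by simp) y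
      simpa using this (by simpa using hy)
    · refine ih _ fun i hi y hy => ?_
      have := h (i + 1) (by simpa using hi) y
      rw [List.take_succ_cons, Ideal.ofList_cons, ← sup_assoc] at this
      exact this hy

theorem wreg_of_isRegular {R : Type*} [CommRing R] (rs : List R)
    (h : RingTheory.Sequence.IsRegular R rs) : WReg rs.length rs.get (⊥ : Ideal R) := by
  refine wreg_of_list _ _ fun i hi y hy => ?_
  have := (isSMulRegular_quotient_iff_mem_of_smul_mem _ _).1 (h.regular_mod_prev i hi) y
  simpa using this (by simpa using hy)
theorem exists_frob_lift {k B C : Type*} [Field k] [CommRing B] [CommRing C] (p : ℕ)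
    [Fact p.Prime] [CharP B p] (g : B →+* C) (hg : Function.Surjective g)
    (hker : ∀ z, g z = 0 → z ^ p = 0) (h : k →+* C) :
    ∃ θ : k →+* B, ∀ r b, g b = h r → θ r = b ^ p := by
  have key : ∀ b c, g b = g c → b ^ p = c ^ p := fun b c hbc => by
    have := hker (b - c) (by rw [map_sub, hbc, sub_self])
    rw [sub_pow_char] at this
    exact sub_eq_zero.1 this
  let s := Function.surjInv hg
  have hs : ∀ c, g (s c) = c := Function.surjInv_eq hg
  refine ⟨
    { toFun := fun r => s (h r) ^ p
      map_one' := ?_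
      map_mul' := ?_
      map_zero' := ?_
      map_add' := ?_ }, ?_⟩
  · rw [key _ 1 (by rw [hs, map_one, map_one]), one_pow]
  · intro x y
    rw [← mul_pow]
    exact key _ _ (by simp only [map_mul, hs])
  · change s (h 0) ^ p = 0
    exact hker _ (by rw [hs, map_zero])
  · intro x y
    change s (h (x + y)) ^ p = s (h x) ^ p + s (h y) ^ p
    rw [← add_pow_char]
    exact key _ _ (by simp only [map_add, hs])
  · intro r b hb
    exact key _ _ (by rw [hs, hb])

set_option maxHeartbeats 1000000 in
theorem exists_field_lift {k B C : Type*} [Field k] [CommRing B] [CommRing C] (p : ℕ)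
    [Fact p.Prime] [CharP B p] [CharP k p] (hfin : (frobenius k p).Finite) (g : B →+* C)
    (hg : Function.Surjective g)
    (hker : ∀ z, g z = 0 → z ^ p = 0) (h : k →+* C) :
    ∃ σ : k →+* B, ∀ r, g (σ r) = h r := by
  obtain ⟨θ, hθ⟩ := exists_frob_lift p g hg hker h
  let K₀ := (frobenius k p).fieldRange
  -- the inverse of Frobenius on `K₀`
  let e : k ≃+* K₀ := RingEquiv.ofBijective (frobenius k p).rangeRestrictField
    ⟨RingHom.injective _, by rintro ⟨_, y, rfl⟩; exact ⟨y, rfl⟩⟩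
  let _ : Algebra K₀ B := (θ.comp e.symm.toRingHom).toAlgebra
  have halg : ∀ y : k, algebraMap K₀ B (e y) = θ y := fun y => by
    change θ (e.symm (e y)) = _
    rw [e.symm_apply_apply]
  have hev : ∀ y : k, ((e y : K₀) : k) = y ^ p := fun y => rfl
  have : FiniteDimensional K₀ k := by
    have : (K₀.subtype).Finite := by
      refine RingHom.Finite.of_comp_finite (f := e.toRingHom) ?_
      exact hfin
    exact this
  have main := IntermediateField.induction_on_adjoin (F := K₀) (E := k)
    (fun L => ∃ ψ : L →ₐ[K₀] B, ∀ y : L, g (ψ y) = h y) ?_ ?_ ⊤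
  · obtain ⟨ψ, hψ⟩ := main
    exact ⟨(ψ.comp (IntermediateField.topEquiv (F := K₀) (E := k)).symm.toAlgHom).toRingHom,
      fun r => hψ _⟩
  · refine ⟨(Algebra.ofId K₀ B).comp (IntermediateField.botEquiv K₀ k).toAlgHom, ?_⟩
    intro y
    obtain ⟨z, rfl⟩ := (IntermediateField.botEquiv K₀ k).symm.surjective y
    obtain ⟨w, rfl⟩ := e.surjective z
    have h1 : ((Algebra.ofId K₀ B).comp (IntermediateField.botEquiv K₀ k).toAlgHom)
        ((IntermediateField.botEquiv K₀ k).symm (e w)) = algebraMap K₀ B (e w) := by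
      simp
    rw [h1, halg]
    obtain ⟨b, hb⟩ := hg (h w)
    rw [hθ w b hb, map_pow, hb, ← map_pow]
    congr 1
  · rintro L x ⟨ψ, hψ⟩
    let _ : Algebra L B := ψ.toRingHom.toAlgebra
    have : IsScalarTower K₀ L B := IsScalarTower.of_algebraMap_eq fun y => (ψ.commutes y).symm
    have hxint : IsIntegral L x := IsIntegral.of_finite L x
    have hpow : ∀ b, g b = h x → b ^ p = algebraMap L B (algebraMap K₀ L (e x)) := fun b hb => by
      rw [← IsScalarTower.algebraMap_apply, halg, hθ x b hb]
    obtain ⟨b, hb, hbx⟩ : ∃ b : B, Polynomial.aeval b (minpoly L x) = 0 ∧ g b = h x := by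
      by_cases hx : x ∈ L
      · refine ⟨ψ ⟨x, hx⟩, ?_, hψ _⟩
        have : minpoly L x = Polynomial.X - Polynomial.C (⟨x, hx⟩ : L) :=
          minpoly.eq_X_sub_C k (⟨x, hx⟩ : L)
        rw [this]
        simp only [map_sub, Polynomial.aeval_X, Polynomial.aeval_C]
        exact sub_self _
      · obtain ⟨b, hb⟩ := hg (h x)
        refine ⟨b, ?_, hb⟩
        have hirr := X_pow_sub_C_irreducible_of_prime (p := p) Fact.out
          (a := algebraMap K₀ L (e x)) (by
            intro c hc
            apply hx
            have h2 : (c : k) ^ p = x ^ p := congrArg (fun z : L => (z : k)) hc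
            have : (c : k) = x := frobenius_inj k p h2
            rw [← this]
            exact c.2)
        rw [← minpoly.eq_of_irreducible_of_monic hirr (x := x) ?_
          (Polynomial.monic_X_pow_sub_C _ (Fact.out : p.Prime).ne_zero)]
        · simp only [map_sub, map_pow, Polynomial.aeval_X, Polynomial.aeval_C]
          rw [hpow b hb, sub_self]
        · simp only [map_sub, map_pow, Polynomial.aeval_X, Polynomial.aeval_C]
          exact sub_self _
    let pb := IntermediateField.adjoin.powerBasis hxint
    have hgen : minpoly L pb.gen = minpoly L x := IntermediateField.minpoly_gen L x
    let Ψ := pb.lift b (by rw [hgen]; exact hb)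
    refine ⟨Ψ.restrictScalars K₀, ?_⟩
    have heq : ∀ y : IntermediateField.adjoin L {x}, g (Ψ y) = h y := by
      intro y
      obtain ⟨f, rfl⟩ := pb.exists_eq_aeval' y
      rw [← Polynomial.aeval_algHom_apply, pb.lift_gen]
      have hy : ((Polynomial.aeval pb.gen f : IntermediateField.adjoin L {x}) : k)
          = Polynomial.aeval x f := by
        have := Polynomial.aeval_algHom_apply (IntermediateField.val (IntermediateField.adjoin L {x})) pb.gen f
        exact this.symm
      rw [hy, Polynomial.aeval_def, Polynomial.aeval_def, Polynomial.hom_eval₂,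
        Polynomial.hom_eval₂, hbx]
      congr 1
      ext z
      exact hψ z
    exact heq
theorem charP_of_ringHom {A B : Type*} [CommRing A] [CommRing B] [Nontrivial B] (p : ℕ)
    [hp : Fact p.Prime] [CharP A p] (f : A →+* B) : CharP B p :=
  (CharP.charP_iff_prime_eq_zero hp.out).2 (by
    rw [← map_natCast f, CharP.cast_eq_zero, map_zero])

theorem frobenius_finite_of_range {R : Type*} [CommRing R] (p : ℕ) [Fact p.Prime] [CharP R p]
    (hF : Module.Finite (↥(frobenius R p).range) R) : (frobenius R p).Finite := by
  have h1 : ((frobenius R p).range.subtype).Finite := hF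
  have h2 := RingHom.Finite.of_surjective _ (frobenius R p).rangeRestrict_surjective
  exact h1.comp h2

theorem frobenius_residue_finite {R : Type*} [CommRing R] [IsLocalRing R] (p : ℕ) [Fact p.Prime]
    [CharP R p] [CharP (IsLocalRing.ResidueField R) p] (hF : (frobenius R p).Finite) :
    (frobenius (IsLocalRing.ResidueField R) p).Finite := by
  refine RingHom.Finite.of_comp_finite (f := IsLocalRing.residue R) ?_
  have : (frobenius (IsLocalRing.ResidueField R) p).comp (IsLocalRing.residue R) =
      (IsLocalRing.residue R).comp (frobenius R p) := by
    ext x; simp [frobenius_def]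
  rw [this]
  exact (RingHom.Finite.of_surjective _ IsLocalRing.residue_surjective).comp hF

open IsLocalRing in
theorem exists_coeff_field {R : Type*} [CommRing R] [IsLocalRing R] (p : ℕ) [Fact p.Prime]
    [CharP R p] (hF : (frobenius R p).Finite) (t : ℕ) :
    ∃ σ : ResidueField R →+* R ⧸ maximalIdeal R ^ (t + 1), ∀ r,
      σ (residue R r) - Ideal.Quotient.mk _ r ∈
        (maximalIdeal R).map (Ideal.Quotient.mk (maximalIdeal R ^ (t + 1))) := by
  have : CharP (ResidueField R) p := charP_of_ringHom p (residue R)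
  induction t with
  | zero =>
    obtain ⟨σ, hσ⟩ : ∃ σ : ResidueField R →+* R ⧸ maximalIdeal R ^ (0 + 1),
        ∀ r, σ (residue R r) = Ideal.Quotient.mk _ r :=
      ⟨Ideal.Quotient.lift (maximalIdeal R) (Ideal.Quotient.mk _) (fun a ha => by
        rw [Ideal.Quotient.eq_zero_iff_mem]; simpa using ha),
        fun r => Ideal.Quotient.lift_mk _ _ _⟩
    exact ⟨σ, fun r => by rw [hσ, sub_self]; exact zero_mem _⟩
  | succ t ih =>
    obtain ⟨σ, hσ⟩ := ih
    have hle : maximalIdeal R ^ (t + 1 + 1) ≤ maximalIdeal R ^ (t + 1) :=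
      Ideal.pow_le_pow_right (by omega)
    have : Nontrivial (R ⧸ maximalIdeal R ^ (t + 1 + 1)) :=
      Ideal.Quotient.nontrivial_iff.2 (ne_top_of_le_ne_top (Ideal.IsPrime.ne_top inferInstance)
        (Ideal.pow_le_self (by omega) : _ ≤ maximalIdeal R))
    have : CharP (R ⧸ maximalIdeal R ^ (t + 1 + 1)) p :=
      charP_of_ringHom p (Ideal.Quotient.mk _)
    obtain ⟨σ', hσ'⟩ := exists_field_lift p (frobenius_residue_finite p hF)
      (Ideal.Quotient.factor hle) (Ideal.Quotient.factor_surjective hle) (by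
        intro z hz
        obtain ⟨z, rfl⟩ := Ideal.Quotient.mk_surjective z
        rw [Ideal.Quotient.factor_mk, Ideal.Quotient.eq_zero_iff_mem] at hz
        rw [← map_pow, Ideal.Quotient.eq_zero_iff_mem]
        have h2 := Ideal.pow_mem_pow hz p
        rw [← pow_mul] at h2
        refine Ideal.pow_le_pow_right ?_ h2
        have := (Fact.out : p.Prime).two_le
        nlinarith) σ
    refine ⟨σ', fun r => ?_⟩
    obtain ⟨z, hz⟩ := Ideal.Quotient.mk_surjective (σ' (residue R r))
    have h1 := hσ r
    rw [← hσ', ← hz, Ideal.Quotient.factor_mk, ← map_sub,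
      Ideal.mem_map_iff_of_surjective _ Ideal.Quotient.mk_surjective] at h1
    obtain ⟨y, hy, hyz⟩ := h1
    rw [← hz, ← map_sub]
    refine Ideal.mem_map_of_mem _ ?_
    rw [Ideal.Quotient.eq] at hyz
    have h3 := sub_mem hy (Ideal.pow_le_self (by omega) hyz)
    simpa using h3

section
open IsLocalRing MvPolynomial

variable {R : Type*} [CommRing R] [IsLocalRing R] {d : ℕ}

/-- the map `k[X] → R / m ^ M` -/
noncomputable def phi (x : Fin d → R) (M : ℕ) (σ : ResidueField R →+* R ⧸ maximalIdeal R ^ M) :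
    MvPolynomial (Fin d) (ResidueField R) →+* R ⧸ maximalIdeal R ^ M :=
  eval₂Hom σ (fun i => Ideal.Quotient.mk _ (x i))

theorem phi_approx (x : Fin d → R)
    (hx : Ideal.span (Set.range x) = maximalIdeal R) (M : ℕ)
    (σ : ResidueField R →+* R ⧸ maximalIdeal R ^ M)
    (hσ : ∀ r, σ (residue R r) - Ideal.Quotient.mk _ r ∈
        (maximalIdeal R).map (Ideal.Quotient.mk (maximalIdeal R ^ M))) (t : ℕ) (G : MvPolynomial (Fin d) R) (hG : G.IsHomogeneous t) :
    phi x M σ (map (residue R) G) - Ideal.Quotient.mk _ (eval x G) ∈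
      (maximalIdeal R ^ (t + 1)).map (Ideal.Quotient.mk (maximalIdeal R ^ M)) := by
  have h1 : phi x M σ (map (residue R) G) =
      ∑ a ∈ G.support, σ (residue R (coeff a G)) * ∏ i ∈ a.support, Ideal.Quotient.mk _ (x i) ^ a i := by
    rw [phi, coe_eval₂Hom, eval₂_map, eval₂_eq]
    rfl
  rw [h1, eval_eq, map_sum, ← Finset.sum_sub_distrib]
  refine Ideal.sum_mem _ fun a ha => ?_
  rw [map_mul, map_prod]
  simp only [map_pow]
  rw [← sub_mul, pow_succ', Ideal.map_mul]
  refine Ideal.mul_mem_mul (hσ _) ?_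
  have : a.degree = t := by
    by_contra hne
    exact (MvPolynomial.mem_support_iff.1 ha) (hG.coeff_eq_zero hne)
  rw [Ideal.map_pow, ← this, Finsupp.degree_apply, ← Finset.prod_pow_eq_pow_sum]
  refine Ideal.prod_mem_prod fun i _ => Ideal.pow_mem_pow (Ideal.mem_map_of_mem _ ?_) _
  rw [← hx]
  exact Ideal.subset_span ⟨i, rfl⟩

theorem phi_surjective (x : Fin d → R)
    (hx : Ideal.span (Set.range x) = maximalIdeal R) (M : ℕ)
    (σ : ResidueField R →+* R ⧸ maximalIdeal R ^ M)
    (hσ : ∀ r, σ (residue R r) - Ideal.Quotient.mk _ r ∈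
        (maximalIdeal R).map (Ideal.Quotient.mk (maximalIdeal R ^ M))) : Function.Surjective (phi x M σ) := by
  have key : ∀ t (r : R), ∃ F, ∃ z ∈ maximalIdeal R ^ t,
      Ideal.Quotient.mk _ r - phi x M σ F = Ideal.Quotient.mk _ z := by
    intro t r
    induction t with
    | zero => exact ⟨0, r, by simp, by simp⟩
    | succ t ih =>
      obtain ⟨F, z, hz, h⟩ := ih
      rw [← hx, Ideal.mem_span_pow_iff_exists_isHomogeneous] at hz
      obtain ⟨G, hG, rfl⟩ := hz
      have h2 := phi_approx x hx M σ hσ t G hG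
      rw [Ideal.mem_map_iff_of_surjective _ Ideal.Quotient.mk_surjective] at h2
      obtain ⟨y, hy, hy2⟩ := h2
      refine ⟨F + map (residue R) G, -y, neg_mem hy, ?_⟩
      rw [map_add, ← sub_sub, h, map_neg, hy2]
      ring
  intro b
  obtain ⟨r, rfl⟩ := Ideal.Quotient.mk_surjective b
  obtain ⟨F, z, hz, h⟩ := key M r
  rw [Ideal.Quotient.eq_zero_iff_mem.2 hz, sub_eq_zero] at h
  exact ⟨F, h.symm⟩

theorem phi_mem (x : Fin d → R)
    (hx : Ideal.span (Set.range x) = maximalIdeal R) (M : ℕ)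
    (σ : ResidueField R →+* R ⧸ maximalIdeal R ^ M) (t : ℕ) (F : MvPolynomial (Fin d) (ResidueField R))
    (hF : F ∈ idealOfVars (Fin d) (ResidueField R) ^ t) :
    phi x M σ F ∈ (maximalIdeal R ^ t).map (Ideal.Quotient.mk (maximalIdeal R ^ M)) := by
  have h1 : (idealOfVars (Fin d) (ResidueField R)).map (phi x M σ) ≤
      (maximalIdeal R).map (Ideal.Quotient.mk (maximalIdeal R ^ M)) := by
    rw [idealOfVars, Ideal.map_span, Ideal.span_le]
    rintro _ ⟨_, ⟨i, rfl⟩, rfl⟩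
    have : phi x M σ (X i) = Ideal.Quotient.mk _ (x i) := by simp [phi]
    rw [this]
    refine Ideal.mem_map_of_mem _ ?_
    rw [← hx]
    exact Ideal.subset_span ⟨i, rfl⟩
  have h2 := Ideal.mem_map_of_mem (phi x M σ) hF
  rw [Ideal.map_pow] at h2 ⊢
  exact Ideal.pow_right_mono h1 t h2

theorem phi_ker [IsNoetherianRing R] (x : Fin d → R)
    (hx : Ideal.span (Set.range x) = maximalIdeal R) (M : ℕ)
    (σ : ResidueField R →+* R ⧸ maximalIdeal R ^ M)
    (hσ : ∀ r, σ (residue R r) - Ideal.Quotient.mk _ r ∈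
        (maximalIdeal R).map (Ideal.Quotient.mk (maximalIdeal R ^ M)))
    (hreg : WReg d x ⊥)
    (F : MvPolynomial (Fin d) (ResidueField R)) (hF : phi x M σ F = 0) :
    F ∈ idealOfVars (Fin d) (ResidueField R) ^ M := by
  have key : ∀ t ≤ M, F ∈ idealOfVars (Fin d) (ResidueField R) ^ t := by
    intro t
    induction t with
    | zero => simp
    | succ t ih =>
      intro ht
      have ih := ih (by omega)
      obtain ⟨G₀, hG₀⟩ := map_surjective (residue R) residue_surjective F
      set G := homogeneousComponent t G₀ with hGdef
      have hG : G.IsHomogeneous t := homogeneousComponent_isHomogeneous t G₀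
      have hcG : ∀ a, a.degree = t → residue R (coeff a G) = coeff a F := by
        intro a ha
        rw [hGdef, coeff_homogeneousComponent, if_pos ha, ← hG₀, coeff_map]
      have hrest : F - map (residue R) G ∈ idealOfVars (Fin d) (ResidueField R) ^ (t + 1) := by
        rw [mem_pow_idealOfVars_iff'] at ih ⊢
        intro a ha
        rw [coeff_sub, coeff_map]
        by_cases hat : a.degree = t
        · rw [hcG a hat, sub_self]
        · rw [hG.coeff_eq_zero hat, ih a (by omega)]; simp
      have h1 := phi_mem x hx M σ _ _ hrest
      rw [map_sub, hF, zero_sub, ← map_neg] at h1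
      have h2 := phi_approx x hx M σ hσ t G hG
      have h3 := add_mem h1 h2
      rw [map_neg, neg_add_eq_sub, sub_sub_cancel_left, ← map_neg,
        Ideal.mem_map_iff_of_surjective _ Ideal.Quotient.mk_surjective] at h3
      obtain ⟨y, hy, hyz⟩ := h3
      rw [Ideal.Quotient.eq] at hyz
      have h4 : eval x G ∈ maximalIdeal R ^ (t + 1) := by
        have := sub_mem (Ideal.pow_le_pow_right ht hyz) hy
        simpa using this
      have h5 := quasiRegular d x ⊥ hreg t G hG (by rw [hx]; simpa using h4)
      rw [mem_pow_idealOfVars_iff'] at ih ⊢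
      intro a ha
      by_cases hat : a.degree = t
      · rw [← hcG a hat, residue_eq_zero_iff]
        have := h5 a
        rw [hx] at this
        simpa using this
      · exact ih a (by omega)
  exact key M le_rfl

end

section DO

variable {R W : Type*} [CommRing R] [AddCommGroup W] [Module R W]

/-- commutator of an additive map with multiplication by `r` -/
def commut (D : R →+ W) (r : R) : R →+ W :=
  D.comp (AddMonoidHom.mulLeft r) - (DistribSMul.toAddMonoidHom W r).comp D

theorem commut_apply (D : R →+ W) (r s : R) : commut D r s = D (r * s) - r • D s := rfl

/-- differential operators with values in a module -/
def IsDO : ℕ → (R →+ W) → Prop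
  | 0, D => ∀ r s : R, D (r * s) = r • D s
  | n + 1, D => ∀ r : R, IsDO n (commut D r)

theorem isDO_iff_isDiffOp (n : ℕ) (D : R →+ R) : IsDO n D ↔ IsDiffOp R n D := by
  induction n generalizing D with
  | zero => exact Iff.rfl
  | succ n ih => exact forall_congr' fun r => ih _

theorem isDO_zero (n : ℕ) : IsDO n (0 : R →+ W) := by
  induction n with
  | zero => intro r s; simp
  | succ n ih =>
    intro r
    have : commut (0 : R →+ W) r = 0 := by ext s; simp [commut_apply]
    rw [this]; exact ih

theorem IsDO.add {n : ℕ} {D D' : R →+ W} (h : IsDO n D) (h' : IsDO n D') : IsDO n (D + D') := by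
  induction n generalizing D D' with
  | zero => intro r s; simp [h r s, h' r s]
  | succ n ih =>
    intro r
    have : commut (D + D') r = commut D r + commut D' r := by
      ext s; simp [commut_apply]; abel
    rw [this]; exact ih (h r) (h' r)

theorem IsDO.smul {n : ℕ} {D : R →+ W} (a : R) (h : IsDO n D) : IsDO n (a • D) := by
  induction n generalizing D with
  | zero => intro r s; simp [h r s, smul_smul, mul_comm]
  | succ n ih =>
    intro r
    have : commut (a • D) r = a • commut D r := by
      ext s; simp [commut_apply, smul_sub, smul_smul, mul_comm]
    rw [this]; exact ih (h r)

theorem IsDO.sum {n : ℕ} {ι : Type*} (s : Finset ι) (D : ι → R →+ W)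
    (h : ∀ i ∈ s, IsDO n (D i)) : IsDO n (∑ i ∈ s, D i) := by
  classical
  induction s using Finset.induction_on with
  | empty => simpa using isDO_zero n
  | insert a s ha ih =>
    rw [Finset.sum_insert ha]
    exact (h a (Finset.mem_insert_self _ _)).add
      (ih fun i hi => h i (Finset.mem_insert_of_mem hi))

theorem IsDO.succ {n : ℕ} {D : R →+ W} (h : IsDO n D) : IsDO (n + 1) D := by
  induction n generalizing D with
  | zero =>
    intro r
    have : commut D r = 0 := by
      ext s; simp [commut_apply, h r s]
    rw [this]; exact isDO_zero 0
  | succ n ih => exact fun r => ih (h r)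

theorem IsDO.mono {n m : ℕ} {D : R →+ W} (h : IsDO n D) (hnm : n ≤ m) : IsDO m D := by
  induction hnm with
  | refl => exact h
  | step _ ih => exact ih.succ

theorem IsDO.map_mem (I : Ideal R) {n : ℕ} {D : R →+ R} (h : IsDO n D) (N : ℕ) (f : R)
    (hf : f ∈ I ^ (n + N)) : D f ∈ I ^ N := by
  induction n generalizing D N f with
  | zero =>
    have := h f 1
    rw [mul_one] at this
    rw [this]
    exact Ideal.mul_mem_right _ _ (by simpa using hf)
  | succ n ih =>
    induction N generalizing f with
    | zero => simp
    | succ N ihN =>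
      rw [show n + 1 + (N + 1) = (n + 1 + N) + 1 by ring, pow_succ'] at hf
      refine Submodule.mul_induction_on hf (fun a ha b hb => ?_) (fun a b ha hb => ?_)
      · have h1 : D (a * b) = a * D b + commut D a b := by simp [commut_apply]
        rw [h1]
        refine add_mem ?_ (ih (h a) (N + 1) b ?_)
        · rw [pow_succ']
          exact Ideal.mul_mem_mul ha (ihN b hb)
        · rwa [show n + (N + 1) = n + 1 + N by ring]
      · rw [map_add]; exact add_mem ha hb

end DO

section Hasse
open MvPolynomial

variable {k σ : Type*} [CommRing k]

/-- Taylor expansion -/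
noncomputable def taylorE : MvPolynomial σ k →+* MvPolynomial σ (MvPolynomial σ k) :=
  eval₂Hom (C.comp C) (fun i => C (X i) + X i)

/-- Hasse derivatives -/
noncomputable def hasse (b : σ →₀ ℕ) : MvPolynomial σ k →+ MvPolynomial σ k :=
  (coeffAddMonoidHom b).comp (taylorE (k := k) (σ := σ)).toAddMonoidHom

theorem hasse_apply (b : σ →₀ ℕ) (F : MvPolynomial σ k) : hasse b F = coeff b (taylorE F) := rfl

theorem constantCoeff_hasse (b : σ →₀ ℕ) (F : MvPolynomial σ k) :
    constantCoeff (hasse b F) = coeff b F := by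
  have h : (map (constantCoeff (σ := σ) (R := k))).comp (taylorE (k := k) (σ := σ)) =
      RingHom.id _ := by
    apply MvPolynomial.ringHom_ext <;> intro i <;> simp [taylorE]
  have h2 := congrArg (coeff b) (RingHom.congr_fun h F)
  simpa [coeff_map, hasse_apply] using h2

theorem hasse_zero (F : MvPolynomial σ k) : hasse 0 F = F := by
  have h : (constantCoeff (σ := σ) (R := MvPolynomial σ k)).comp (taylorE (k := k) (σ := σ)) =
      RingHom.id _ := by
    apply MvPolynomial.ringHom_ext <;> intro i <;> simp [taylorE]
  exact RingHom.congr_fun h F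

theorem commut_hasse [DecidableEq σ] (b : σ →₀ ℕ) (F : MvPolynomial σ k) :
    commut (hasse b) F = ∑ c ∈ (Finset.HasAntidiagonal.antidiagonal b).erase (0, b), hasse c.1 F • hasse c.2 := by
  refine AddMonoidHom.ext fun G => ?_
  rw [commut_apply, AddMonoidHom.finsetSum_apply, hasse_apply, map_mul, coeff_mul,
    ← Finset.add_sum_erase _ _ (show ((0 : σ →₀ ℕ), b) ∈ Finset.HasAntidiagonal.antidiagonal b by simp)]
  simp only [← hasse_apply, hasse_zero]
  simp

theorem isDO_hasse (n : ℕ) (b : σ →₀ ℕ) (hb : b.degree ≤ n) :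
    IsDO n (hasse b : MvPolynomial σ k →+ MvPolynomial σ k) := by
  classical
  induction n generalizing b with
  | zero =>
    have : b = 0 := by simpa [Finsupp.degree_eq_zero_iff] using hb
    subst this
    intro r s
    simp [hasse_zero]
  | succ n ih =>
    intro F
    rw [commut_hasse]
    refine IsDO.sum _ _ fun c hc => (ih _ ?_).smul _
    rw [Finset.mem_erase, Finset.HasAntidiagonal.mem_antidiagonal] at hc
    obtain ⟨hc, h⟩ := hc
    have h1 : c.1 ≠ 0 := by
      intro h0
      apply hc
      rw [h0, zero_add] at h
      exact Prod.ext h0 h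
    have h2 : c.1.degree ≠ 0 := by simpa [Finsupp.degree_eq_zero_iff] using h1
    have h3 : c.1.degree + c.2.degree = b.degree := by rw [← h, map_add]
    omega

end Hasse

section Transfer

variable {S R A W : Type*} [CommRing S] [CommRing R] [CommRing A] [AddCommGroup W] [Module R W]

theorem exists_transfer (φ : S →+* A) (hφ : Function.Surjective φ) (mk : R →+* A)
    (ψ : S →+ W) (H : S →+ S) (hker : ∀ F, φ F = 0 → ψ (H F) = 0) :
    ∃ D : R →+ W, ∀ F r, φ F = mk r → D r = ψ (H F) := by
  choose g hg using fun r => hφ (mk r)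
  have key : ∀ F r, φ F = mk r → ψ (H (g r)) = ψ (H F) := by
    intro F r h
    rw [← sub_eq_zero, ← map_sub, ← map_sub]
    exact hker _ (by rw [map_sub, hg, h, sub_self])
  refine ⟨AddMonoidHom.mk' (fun r => ψ (H (g r))) (fun a b => ?_), key⟩
  rw [← map_add, ← map_add]
  exact key _ _ (by simp [hg])

theorem isDO_transfer (φ : S →+* A) (hφ : Function.Surjective φ) (mk : R →+* A)
    (ψ : S →+ W) (hψ : ∀ F G r, φ F = mk r → ψ (F * G) = r • ψ G) (n : ℕ) (H : S →+ S)
    (D : R →+ W) (hD : ∀ F r, φ F = mk r → D r = ψ (H F)) (hH : IsDO n H) : IsDO n D := by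
  induction n generalizing H D with
  | zero =>
    intro r s
    obtain ⟨F, hF⟩ := hφ (mk r)
    obtain ⟨G, hG⟩ := hφ (mk s)
    rw [hD (F * G) (r * s) (by simp [hF, hG]), hD G s hG, hH F G, smul_eq_mul, hψ _ _ _ hF]
  | succ n ih =>
    intro r
    obtain ⟨F, hF⟩ := hφ (mk r)
    refine ih (commut H F) _ (fun G s hG => ?_) (hH F)
    rw [commut_apply, commut_apply, hD (F * G) (r * s) (by simp [hF, hG]), hD G s hG, map_sub,
      smul_eq_mul, hψ _ _ _ hF]

end Transfer

section Principal
open TensorProduct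

variable {R W : Type*} [CommRing R] [AddCommGroup W] [Module R W]

/-- the linearization -/
noncomputable def hatD (D : R →+ W) : R ⊗[ℤ] R →ₗ[R] W := D.toIntLinearMap.liftBaseChange R

theorem hatD_tmul (D : R →+ W) (r s : R) : hatD D (r ⊗ₜ s) = r • D s := by
  simp [hatD]

/-- generators of the diagonal ideal -/
def dgen (r : R) : R ⊗[ℤ] R := 1 ⊗ₜ r - r ⊗ₜ 1

/-- the diagonal ideal -/
def diagI (R : Type*) [CommRing R] : Ideal (R ⊗[ℤ] R) := Ideal.span (Set.range dgen)

theorem hatD_mul (D : R →+ W) (r : R) (w : R ⊗[ℤ] R) :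
    hatD D (dgen r * w) = hatD (commut D r) w := by
  induction w using TensorProduct.induction_on with
  | zero => simp
  | tmul a b =>
    rw [dgen, sub_mul, Algebra.TensorProduct.tmul_mul_tmul, Algebra.TensorProduct.tmul_mul_tmul,
      map_sub, hatD_tmul, hatD_tmul, hatD_tmul, commut_apply, smul_sub, smul_smul, one_mul, one_mul,
      mul_comm a r]
  | add a b ha hb => rw [mul_add, map_add, map_add, ha, hb]

theorem diagI_pow_succ (n : ℕ) : diagI R ^ (n + 1) = diagI R * diagI R ^ n :=
  pow_succ' (M := Ideal (R ⊗[ℤ] R)) (diagI R) n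

theorem kill_succ (D : R →+ W) (n : ℕ) :
    (∀ w ∈ diagI R ^ (n + 1), hatD D w = 0) ↔
      ∀ r, ∀ w ∈ diagI R ^ n, hatD (commut D r) w = 0 := by
  constructor
  · intro h r w hw
    rw [← hatD_mul]
    refine h _ ?_
    rw [diagI_pow_succ]
    exact Ideal.mul_mem_mul (Ideal.subset_span ⟨r, rfl⟩) hw
  · intro h w hw
    rw [diagI_pow_succ] at hw
    refine Submodule.mul_induction_on hw (fun a ha b hb => ?_) (fun a b ha hb => ?_)
    · induction ha using Submodule.span_induction generalizing b with
      | mem x hx =>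
        obtain ⟨r, rfl⟩ := hx
        rw [hatD_mul]
        exact h r b hb
      | zero => simp
      | add x y _ _ hx hy => rw [add_mul, map_add, hx b hb, hy b hb, add_zero]
      | smul c x _ hx =>
        rw [smul_eq_mul, mul_comm c, mul_assoc]
        exact hx _ (Ideal.mul_mem_left _ _ hb)
    · rw [map_add, ha, hb, add_zero]

theorem isDO_iff_kill (n : ℕ) (D : R →+ W) :
    IsDO n D ↔ ∀ w ∈ diagI R ^ (n + 1), hatD D w = 0 := by
  induction n generalizing D with
  | zero =>
    rw [kill_succ]
    constructor
    · intro h r w _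
      have : commut D r = 0 := by ext s; simp [commut_apply, h r s]
      rw [this]
      induction w using TensorProduct.induction_on with
      | zero => simp
      | tmul a b => simp [hatD_tmul]
      | add a b ha hb => simp [ha, hb]
    · intro h r s
      have := h r (1 ⊗ₜ s) (by simp)
      rw [hatD_tmul, one_smul, commut_apply, sub_eq_zero] at this
      exact this
  | succ n ih =>
    rw [kill_succ]
    exact forall_congr' fun r => ih _

/-- module of principal parts of order `n - 1` -/
abbrev PP (R : Type*) [CommRing R] (n : ℕ) : Type _ :=
  (R ⊗[ℤ] R) ⧸ ((diagI R ^ n).restrictScalars R)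

theorem iterateFrobenius_finite (p : ℕ) [Fact p.Prime] [CharP R p]
    (hF : (frobenius R p).Finite) (e : ℕ) : (iterateFrobenius R p e).Finite := by
  induction e with
  | zero =>
    rw [iterateFrobenius_zero]
    exact RingHom.Finite.id R
  | succ e ih =>
    have : iterateFrobenius R p (e + 1) = (frobenius R p).comp (iterateFrobenius R p e) := by
      ext x; simp [frobenius_def, iterateFrobenius_def, pow_succ, pow_mul]
    rw [this]
    exact hF.comp ih

theorem pp_finite (p : ℕ) [Fact p.Prime] [CharP R p] [Nontrivial R]
    (hF : (frobenius R p).Finite) (n : ℕ) : Module.Finite R (PP R n) := by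
  have : Nontrivial (R ⊗[ℤ] R) :=
    (Algebra.TensorProduct.lmul' ℤ (S := R)).toRingHom.domain_nontrivial
  have : CharP (R ⊗[ℤ] R) p :=
    charP_of_ringHom p (Algebra.TensorProduct.includeLeftRingHom : R →+* R ⊗[ℤ] R)
  have : ExpChar (R ⊗[ℤ] R) p := ExpChar.prime Fact.out
  obtain ⟨e, he⟩ : ∃ e, n ≤ p ^ e := ⟨n, (Nat.lt_pow_self (Fact.out : p.Prime).one_lt).le⟩
  have hgen : ∀ c : R, dgen c ∈ diagI R := fun c => Ideal.subset_span ⟨c, rfl⟩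
  have hpow : ∀ c : R, dgen (c ^ p ^ e) ∈ diagI R ^ n := by
    intro c
    have : dgen (c ^ p ^ e) = dgen c ^ p ^ e := by
      rw [dgen, dgen, sub_pow_expChar_pow]
      simp [Algebra.TensorProduct.tmul_pow]
    rw [this]
    exact Ideal.pow_le_pow_right he (Ideal.pow_mem_pow (hgen c) _)
  have hfin := iterateFrobenius_finite p hF e
  let alg := (iterateFrobenius R p e).toAlgebra
  have hfin' : @Module.Finite R R _ _ alg.toModule := hfin
  obtain ⟨G, hG⟩ := hfin'.fg_top
  let T : Submodule R (PP R n) :=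
    Submodule.span R ((fun g : R => Submodule.Quotient.mk (1 ⊗ₜ g)) '' (G : Set R))
  have hT1 : ∀ b : R, (Submodule.Quotient.mk (1 ⊗ₜ b) : PP R n) ∈ T := by
    intro b
    have hb : b ∈ @Submodule.span R R _ _ alg.toModule (G : Set R) := by rw [hG]; trivial
    induction hb using Submodule.span_induction with
    | mem x hx => exact Submodule.subset_span ⟨x, hx, rfl⟩
    | zero => rw [TensorProduct.tmul_zero]; exact zero_mem _
    | add x y _ _ hx hy => rw [TensorProduct.tmul_add]; exact add_mem hx hy
    | smul c x _ hx =>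
      have h1 : (alg.toModule.toSMul.smul c x) = c ^ p ^ e * x := by
        rw [← iterateFrobenius_def]; rfl
      have h2 : (1 ⊗ₜ (c ^ p ^ e * x) : R ⊗[ℤ] R) =
          c ^ p ^ e • (1 ⊗ₜ x) + (1 ⊗ₜ x) * dgen (c ^ p ^ e) := by
        rw [dgen, mul_sub, Algebra.TensorProduct.tmul_mul_tmul,
          Algebra.TensorProduct.tmul_mul_tmul, TensorProduct.smul_tmul']
        simp [mul_comm]
      have h3 : (Submodule.Quotient.mk ((1 ⊗ₜ x) * dgen (c ^ p ^ e)) : PP R n) = 0 :=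
        (Submodule.Quotient.mk_eq_zero _).2 (Ideal.mul_mem_left _ _ (hpow c))
      change (Submodule.Quotient.mk (1 ⊗ₜ (alg.toModule.toSMul.smul c x)) : PP R n) ∈ T
      rw [h1, h2, Submodule.Quotient.mk_add, h3, add_zero, Submodule.Quotient.mk_smul]
      exact T.smul_mem _ hx
  have hT : T = ⊤ := by
    rw [eq_top_iff]
    rintro z -
    obtain ⟨z, rfl⟩ := Submodule.Quotient.mk_surjective _ z
    induction z using TensorProduct.induction_on with
    | zero => exact zero_mem _
    | tmul a b =>
      have : (a ⊗ₜ b : R ⊗[ℤ] R) = a • (1 ⊗ₜ b) := by simp [TensorProduct.smul_tmul']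
      rw [this, Submodule.Quotient.mk_smul]
      exact T.smul_mem _ (hT1 b)
    | add a b ha hb => rw [Submodule.Quotient.mk_add]; exact add_mem ha hb
  refine Module.Finite.of_fg_top ?_
  rw [← hT]
  exact Submodule.fg_span (G.finite_toSet.image _)

end Principal

theorem exists_lift {R P : Type*} [CommRing R] [IsNoetherianRing R] [AddCommGroup P] [Module R P]
    [Module.Finite R P] (I : Ideal R) : ∃ N, 1 ≤ N ∧ ∀ φ : P →ₗ[R] R ⧸ I ^ N, ∃ ψ : P →ₗ[R] R,
      ∀ z, ∃ y, φ z = Ideal.Quotient.mk _ y ∧ ψ z - y ∈ I := by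
  obtain ⟨a, π, hπ⟩ := Module.Finite.exists_fin' R P
  obtain ⟨b, κ, hκ⟩ := Module.Finite.exists_fin' R (LinearMap.ker π)
  let B := Pi.basisFun R (Fin a)
  let A : (Fin a → R) →ₗ[R] (Fin b → R) :=
    LinearMap.pi fun j => (B.constr R).symm.symm.toLinearMap.flip (κ (Pi.single j 1) : Fin a → R)
  have hA : ∀ v j, A v j = ∑ i, v i * (κ (Pi.single j 1) : Fin a → R) i := by
    intro v j
    simp [A, B, Module.Basis.constr_apply_fintype, mul_comm]
  obtain ⟨N, hN1, hN⟩ := qr_artinRees I A 1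
  refine ⟨N, hN1, fun φ => ?_⟩
  choose v hv using fun i => Ideal.Quotient.mk_surjective (φ (π (Pi.single i 1)))
  have hlin : ∀ u : Fin a → R, φ (π u) = Ideal.Quotient.mk _ (∑ i, v i * u i) := by
    intro u
    conv_lhs => rw [← (Pi.basisFun R (Fin a)).sum_repr u]
    rw [map_sum, map_sum, map_sum]
    refine Finset.sum_congr rfl fun i _ => ?_
    simp only [Pi.basisFun_repr, Pi.basisFun_apply, map_smul, ← hv, map_mul]
    rw [Algebra.smul_def, mul_comm]
    rfl
  have hAv : A v ∈ (I ^ N • ⊤ : Submodule R (Fin b → R)) := by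
    rw [← (Pi.basisFun R (Fin b)).sum_repr (A v)]
    refine Submodule.sum_mem _ fun j _ => Submodule.smul_mem_smul ?_ trivial
    rw [Pi.basisFun_repr, hA, ← Ideal.Quotient.eq_zero_iff_mem, ← hlin,
      LinearMap.mem_ker.1 (κ (Pi.single j 1)).2, map_zero]
  obtain ⟨w, hw, hAw⟩ := hN v hAv
  have hwI : ∀ i, w i ∈ I := by
    intro i
    refine Submodule.smul_induction_on hw (fun r hr u _ => ?_) (fun u u' hu hu' => ?_)
    · rw [pow_one] at hr
      exact Ideal.mul_mem_right _ _ hr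
    · exact add_mem hu hu'
  let L : (Fin a → R) →ₗ[R] R := B.constr R (v - w)
  have hL : ∀ u, L u = ∑ i, (v i - w i) * u i := by
    intro u
    simp only [L, B, Module.Basis.constr_apply_fintype, Pi.basisFun_equivFun, Pi.sub_apply,
      LinearEquiv.refl_apply, smul_eq_mul, mul_comm]
  have hker : LinearMap.ker π ≤ LinearMap.ker L := by
    intro u hu
    obtain ⟨c, hc⟩ := hκ ⟨u, hu⟩
    have h1 : ∀ j, L (κ (Pi.single j 1) : Fin a → R) = 0 := by
      intro j
      have := congrFun hAw j
      rw [hA, hA] at this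
      rw [hL]
      simp only [sub_mul, Finset.sum_sub_distrib, this, sub_self]
    have h2 : (L ∘ₗ (LinearMap.ker π).subtype ∘ₗ κ) = 0 := by
      refine (Pi.basisFun R (Fin b)).ext fun j => ?_
      simpa using h1 j
    have h3 := LinearMap.congr_fun h2 c
    simp only [LinearMap.comp_apply, hc] at h3
    simpa using h3
  let ψ : P →ₗ[R] R := (LinearMap.ker π).liftQ L hker ∘ₗ
    (π.quotKerEquivOfSurjective hπ).symm.toLinearMap
  have hψ : ∀ u, ψ (π u) = L u := by
    intro u
    have : (π.quotKerEquivOfSurjective hπ).symm (π u) = Submodule.Quotient.mk u := by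
      rw [LinearEquiv.symm_apply_eq]
      simp
    simp [ψ, this]
  refine ⟨ψ, fun z => ?_⟩
  obtain ⟨u, rfl⟩ := hπ z
  refine ⟨_, hlin u, ?_⟩
  rw [hψ, hL, ← Finset.sum_sub_distrib]
  refine Ideal.sum_mem _ fun i _ => ?_
  rw [← sub_mul, sub_sub_cancel_left]
  exact Ideal.mul_mem_right _ _ (neg_mem (hwI i))

open IsLocalRing MvPolynomial TensorProduct in
theorem exists_diffOp {R : Type*} [CommRing R] [IsLocalRing R] [IsNoetherianRing R] (p : ℕ)
    [Fact p.Prime] [CharP R p] (hF : (frobenius R p).Finite) {d : ℕ} (x : Fin d → R)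
    (hx : Ideal.span (Set.range x) = maximalIdeal R) (hreg : WReg d x ⊥) (f : R) (n : ℕ)
    (hf : f ∉ maximalIdeal R ^ (n + 1)) :
    ∃ D : R →+ R, IsDO n D ∧ D f ∉ maximalIdeal R := by
  have := pp_finite p hF (n + 1)
  obtain ⟨N, hN1, hN⟩ := exists_lift (P := PP R (n + 1)) (maximalIdeal R)
  obtain ⟨σ, hσ⟩ := exists_coeff_field p hF (n + N)
  have hle : maximalIdeal R ^ (n + N + 1) ≤ maximalIdeal R ^ N :=
    Ideal.pow_le_pow_right (by omega)
  have hsurj := phi_surjective x hx _ σ hσ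
  obtain ⟨F, hFf⟩ := hsurj (Ideal.Quotient.mk _ f)
  obtain ⟨b, hb, hbF⟩ : ∃ b : Fin d →₀ ℕ, b.degree < n + 1 ∧ coeff b F ≠ 0 := by
    by_contra hcon
    push Not at hcon
    have h1 : F ∈ idealOfVars (Fin d) (ResidueField R) ^ (n + 1) :=
      (mem_pow_idealOfVars_iff' _ _).2 hcon
    have h2 := phi_mem x hx _ σ _ F h1
    rw [hFf, Ideal.mem_map_iff_of_surjective _ Ideal.Quotient.mk_surjective] at h2
    obtain ⟨y, hy, hyf⟩ := h2
    rw [Ideal.Quotient.eq] at hyf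
    have h3 := sub_mem hy (Ideal.pow_le_pow_right (by omega) hyf)
    rw [sub_sub_cancel] at h3
    exact hf h3
  have hH : IsDO n (hasse b : MvPolynomial (Fin d) (ResidueField R) →+ _) :=
    isDO_hasse n b (by omega)
  let ψ : MvPolynomial (Fin d) (ResidueField R) →+* R ⧸ maximalIdeal R ^ N :=
    (Ideal.Quotient.factor hle).comp (phi x _ σ)
  have hψ : ∀ t G, G ∈ idealOfVars (Fin d) (ResidueField R) ^ t →
      ∃ y ∈ maximalIdeal R ^ t, ψ G = Ideal.Quotient.mk _ y := by
    intro t G hG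
    have h2 := phi_mem x hx _ σ _ G hG
    rw [Ideal.mem_map_iff_of_surjective _ Ideal.Quotient.mk_surjective] at h2
    obtain ⟨y, hy, hyf⟩ := h2
    exact ⟨y, hy, by simp only [ψ, RingHom.comp_apply, ← hyf, Ideal.Quotient.factor_mk]⟩
  obtain ⟨D, hD⟩ := exists_transfer (phi x _ σ) hsurj (Ideal.Quotient.mk _) ψ.toAddMonoidHom
    (hasse b) (by
      intro G hG
      have h1 := phi_ker x hx _ σ hσ hreg G hG
      have h2 := hH.map_mem _ N G (Ideal.pow_le_pow_right (by omega) h1)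
      obtain ⟨y, hy, hyG⟩ := hψ _ _ h2
      exact hyG.trans (Ideal.Quotient.eq_zero_iff_mem.2 hy))
  have hDO : IsDO n D := isDO_transfer (phi x _ σ) hsurj (Ideal.Quotient.mk _)
    ψ.toAddMonoidHom (by
      intro G G' r h
      change ψ (G * G') = r • ψ G'
      rw [map_mul, Algebra.smul_def]
      congr 1
      simp only [ψ, RingHom.comp_apply, h, Ideal.Quotient.factor_mk]
      rfl) n (hasse b) D hD hH
  have hkill := (isDO_iff_kill n D).1 hDO
  obtain ⟨θ, hθ⟩ := hN (((diagI R ^ (n + 1)).restrictScalars R).liftQ (hatD D) hkill)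
  let D' : R →+ R := AddMonoidHom.mk' (fun r => θ (Submodule.Quotient.mk (1 ⊗ₜ r)))
    (fun r s => by rw [TensorProduct.tmul_add, Submodule.Quotient.mk_add, map_add])
  have hD' : hatD D' = θ ∘ₗ Submodule.mkQ _ := by
    refine LinearMap.ext fun z => ?_
    induction z using TensorProduct.induction_on with
    | zero => simp
    | tmul a c =>
      have : (a ⊗ₜ c : R ⊗[ℤ] R) = a • (1 ⊗ₜ c) := by simp [TensorProduct.smul_tmul']
      rw [hatD_tmul, this, map_smul]
      rfl
    | add u v hu hv => rw [map_add, map_add, hu, hv]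
  refine ⟨D', (isDO_iff_kill n D').2 fun w hw => ?_, fun hmem => ?_⟩
  · have h0 : (Submodule.Quotient.mk w : PP R (n + 1)) = 0 :=
      (Submodule.Quotient.mk_eq_zero _).2 hw
    rw [hD', LinearMap.comp_apply, Submodule.mkQ_apply, h0, map_zero]
  · obtain ⟨y, hy, hy2⟩ := hθ (Submodule.Quotient.mk (1 ⊗ₜ f))
    have h1 : y ∈ maximalIdeal R := by
      have := sub_mem hmem hy2
      change θ _ - (θ _ - y) ∈ _ at this
      rwa [sub_sub_cancel] at this
    have h2 : ψ (hasse b F) = Ideal.Quotient.mk _ y := by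
      rw [← hy]
      have h3 : D f = ψ (hasse b F) := hD F f hFf
      rw [← h3]
      change D f = hatD D (1 ⊗ₜ f)
      rw [hatD_tmul, one_smul]
    have hc : C (coeff b F) - hasse b F ∈ idealOfVars (Fin d) (ResidueField R) ^ 1 := by
      rw [mem_pow_idealOfVars_iff']
      intro a ha
      have ha0 : a = 0 := by
        rw [← Finsupp.degree_eq_zero_iff]; omega
      subst ha0
      have := constantCoeff_hasse b F
      rw [constantCoeff_eq] at this
      rw [coeff_sub, this]
      simp
    obtain ⟨y', hy', h4⟩ := hψ _ _ hc
    rw [pow_one] at hy'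
    have h5 : ψ (C (coeff b F)) = Ideal.Quotient.mk _ (y' + y) := by
      rw [map_add, ← h4, ← h2, map_sub, sub_add_cancel]
    have hu : IsUnit (ψ (C (coeff b F))) := ((isUnit_iff_ne_zero.2 hbF).map C).map ψ
    rw [h5] at hu
    obtain ⟨z, hz⟩ := hu.exists_right_inv
    obtain ⟨z, rfl⟩ := Ideal.Quotient.mk_surjective z
    rw [← map_mul, ← map_one (Ideal.Quotient.mk (maximalIdeal R ^ N)), Ideal.Quotient.eq] at hz
    have h6 := sub_mem (Ideal.mul_mem_right z _ (add_mem hy' h1))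
      (Ideal.pow_le_self (by omega) hz)
    rw [sub_sub_cancel] at h6
    exact (Ideal.ne_top_iff_one _).1 (Ideal.IsPrime.ne_top inferInstance) h6

/-- Local Jacobian criterion: in an `F`-finite regular local ring `(R, m)` of
characteristic `p > 0`, `f ∈ m ^ n` iff `D f ∈ m` for every differential operator `D` of
order at most `n - 1`. -/
theorem mem_pow_maximalIdeal_iff_diffOp
    (R : Type*) [CommRing R] [IsDomain R] [IsLocalRing R] (hreg : IsRegularLocal R)
    (p : ℕ) [Fact p.Prime] [CharP R p]
    (hF : Module.Finite (↥(frobenius R p).range) R)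
    (f : R) (n : ℕ) (hn : 1 ≤ n) :
    f ∈ IsLocalRing.maximalIdeal R ^ n ↔
      ∀ D : R →+ R, IsDiffOp R (n - 1) D → D f ∈ IsLocalRing.maximalIdeal R := by
  obtain ⟨n, rfl⟩ : ∃ m, n = m + 1 := ⟨n - 1, by omega⟩
  rw [Nat.add_sub_cancel]
  obtain ⟨hnoeth, rs, hrs, hspan⟩ := hreg
  constructor
  · intro hf D hD
    have := ((isDO_iff_isDiffOp n D).2 hD).map_mem _ 1 f hf
    rwa [pow_one] at this
  · intro h
    by_contra hf
    have hx : Ideal.span (Set.range rs.get) = IsLocalRing.maximalIdeal R := by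
      rw [← hspan, Set.range_list_get]
    obtain ⟨D, hD, hDf⟩ := exists_diffOp p (frobenius_finite_of_range p hF) rs.get hx
      (wreg_of_isRegular rs hrs) f n hf
    exact hDf (h D ((isDO_iff_isDiffOp n D).1 hD))
end

section
/- Let R be an F-finite regular local ring of characteristic p > 0 and q = p^e. Then R^q = { f ∈ R : D(f) = 0 for every differential operator D of order at most q − 1 with D(1) = 0 }. -/
section
universe u
open Polynomial RingTheory.Sequence

theorem liftStep {K A B : Type u} [Field K] [CommRing A] [CommRing B] (p : ℕ) [Fact p.Prime]
    [CharP K p] [CharP A p] (π : A →+* B) (_hπ : Function.Surjective π)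
    (_hker : ∀ a, π a = 0 → a ^ p = 0) (φ0 : K →+* B) (ψ : K →+* A)
    (hψ : ∀ a c, π a = φ0 c → a ^ p = ψ c)
    (F : Type u) [Field F] (i : F →+* K) (φ : F →+* A) (h1 : ∀ z, π (φ z) = φ0 (i z))
    (h2 : ∀ c, ∃ z, i z = c ^ p ∧ φ z = ψ c) (y : K) (hy : ∀ z, i z ≠ y) (y' : A)
    (hy' : π y' = φ0 y) :
    ∃ (F' : Type u) (_ : Field F') (j : F →+* F') (i' : F' →+* K) (φ' : F' →+* A),
      (∀ z, i' (j z) = i z) ∧ (∀ z, φ' (j z) = φ z) ∧ (∀ z, π (φ' z) = φ0 (i' z)) ∧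
      (∃ z, i' z = y ∧ φ' z = y') := by
  obtain ⟨w, hw, hw'⟩ := h2 y
  have hirr : Irreducible (X ^ p - C w : F[X]) := by
    refine X_pow_sub_C_irreducible_of_prime Fact.out ?_
    intro b hb
    apply hy b
    apply frobenius_inj K p
    simp only [frobenius_def]
    rw [← hw, ← hb, map_pow]
  have : Fact (Irreducible (X ^ p - C w : F[X])) := ⟨hirr⟩
  have e1 : (X ^ p - C w : F[X]).eval₂ i y = 0 := by simp [hw]
  have e2 : (X ^ p - C w : F[X]).eval₂ φ y' = 0 := by simp [hw', hψ _ _ hy']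
  refine ⟨AdjoinRoot (X ^ p - C w : F[X]), inferInstance, AdjoinRoot.of _,
    AdjoinRoot.lift i y e1, AdjoinRoot.lift φ y' e2, ?_, ?_, ?_, ?_⟩
  · intro z; simp
  · intro z; simp
  · intro z
    have : π.comp (AdjoinRoot.lift φ y' e2) = φ0.comp (AdjoinRoot.lift i y e1) := by
      apply AdjoinRoot.ringHom_ext
      · ext z; simp [h1]
      · simp [hy']
    exact congrArg (fun f => f z) this
  · exact ⟨AdjoinRoot.root _, by simp, by simp⟩

theorem liftPsi {K A B : Type u} [Field K] [CommRing A] [CommRing B] (p : ℕ) [Fact p.Prime]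
    [CharP K p] [CharP A p] (π : A →+* B) (hπ : Function.Surjective π)
    (hker : ∀ a, π a = 0 → a ^ p = 0) (φ0 : K →+* B) :
    ∃ ψ : K →+* A, ∀ a c, π a = φ0 c → a ^ p = ψ c := by
  have key : ∀ a b, π a = π b → a ^ p = b ^ p := by
    intro a b h
    have := hker (a - b) (by simp [h])
    rw [sub_pow_char] at this
    exact sub_eq_zero.mp this
  have hs := Function.surjInv_eq hπ
  set σ := Function.surjInv hπ
  refine ⟨{ toFun := fun c => σ (φ0 c) ^ p
            map_one' := ?_, map_mul' := ?_, map_zero' := ?_, map_add' := ?_ }, ?_⟩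
  · rw [key _ 1 (by simp [hs]), one_pow]
  · intro x y
    rw [← mul_pow]; apply key; simp [hs]
  · rw [key _ 0 (by simp [hs]), zero_pow (Fact.out : p.Prime).ne_zero]
  · intro x y
    rw [← add_pow_char]; apply key; simp [hs]
  · intro a c h
    apply key; simp [hs, h]

theorem liftHom {K A B : Type u} [Field K] [CommRing A] [CommRing B] (p : ℕ) [Fact p.Prime]
    [CharP K p] [CharP A p] (π : A →+* B) (hπ : Function.Surjective π)
    (hker : ∀ a, π a = 0 → a ^ p = 0) (φ0 : K →+* B)
    (T : Finset K) (hT : ∀ E : Subfield K, (∀ c, c ^ p ∈ E) → (∀ t ∈ T, t ∈ E) → E = ⊤)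
    (g : K) (hg : ∀ x, g ≠ x ^ p) (g' : A) (hg' : π g' = φ0 g) :
    ∃ φ : K →+* A, (∀ x, π (φ x) = φ0 x) ∧ φ g = g' := by
  classical
  obtain ⟨ψ, hψ⟩ := liftPsi p π hπ hker φ0
  have main : ∀ S : Finset K, ∃ (F : Type u) (_ : Field F) (i : F →+* K) (φ : F →+* A),
      (∀ z, π (φ z) = φ0 (i z)) ∧ (∀ c, ∃ z, i z = c ^ p ∧ φ z = ψ c) ∧
      (∃ z, i z = g ∧ φ z = g') ∧ ∀ t ∈ S, ∃ z, i z = t := by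
    intro S
    induction S using Finset.induction_on with
    | empty =>
      obtain ⟨F', _, j, i', φ', h1, h2, h3, h4⟩ := liftStep p π hπ hker φ0 ψ hψ K (frobenius K p) ψ
        (by
          intro z
          obtain ⟨a, ha⟩ := hπ (φ0 z)
          rw [← hψ a z ha, map_pow, ha, frobenius_def, map_pow])
        (fun c => ⟨c, rfl, rfl⟩) g (fun z h => hg z h.symm) g' hg'
      exact ⟨F', _, i', φ', h3, fun c => ⟨j c, by rw [h1]; rfl, h2 c⟩, h4, by simp⟩
    | insert y S hyS ih =>
      obtain ⟨F, _, i, φ, h1, h2, h3, h4⟩ := ih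
      by_cases hy : ∃ z, i z = y
      · refine ⟨F, _, i, φ, h1, h2, h3, ?_⟩
        intro t ht
        rcases Finset.mem_insert.mp ht with rfl | ht
        · exact hy
        · exact h4 t ht
      · push Not at hy
        obtain ⟨y', hy'⟩ := hπ (φ0 y)
        obtain ⟨F', _, j, i', φ', g1, g2, g3, z0, g4, g5⟩ :=
          liftStep p π hπ hker φ0 ψ hψ F i φ h1 h2 y hy y' hy'
        refine ⟨F', _, i', φ', g3, ?_, ?_, ?_⟩
        · intro c
          obtain ⟨z, hz, hz'⟩ := h2 c
          exact ⟨j z, by rw [g1, hz], by rw [g2, hz']⟩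
        · obtain ⟨z, hz, hz'⟩ := h3
          exact ⟨j z, by rw [g1, hz], by rw [g2, hz']⟩
        · intro t ht
          rcases Finset.mem_insert.mp ht with rfl | ht
          · exact ⟨z0, g4⟩
          · obtain ⟨z, hz⟩ := h4 t ht
            exact ⟨j z, by rw [g1, hz]⟩
  obtain ⟨F, _, i, φ, h1, h2, ⟨z0, h3, h3'⟩, h4⟩ := main T
  have hsurj : Function.Surjective i := by
    have := hT i.fieldRange (fun c => by
      obtain ⟨z, hz, _⟩ := h2 c
      exact ⟨z, hz⟩) (fun t ht => h4 t ht)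
    intro x
    have hx : x ∈ i.fieldRange := by rw [this]; trivial
    exact hx
  let E := RingEquiv.ofBijective i ⟨i.injective, hsurj⟩
  have hE : ∀ x, i (E.symm x) = x := fun x => E.apply_symm_apply x
  refine ⟨φ.comp E.symm.toRingHom, ?_, ?_⟩
  · intro x
    simp [h1, hE]
  · have : E.symm g = z0 := by rw [← h3]; exact E.symm_apply_apply z0
    simp [this, h3']

theorem truncHom {K : Type u} [Field K] (p : ℕ) [Fact p.Prime] [CharP K p]
    (T : Finset K) (hT : ∀ E : Subfield K, (∀ c, c ^ p ∈ E) → (∀ t ∈ T, t ∈ E) → E = ⊤)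
    (g : K) (hg : ∀ x, g ≠ x ^ p) (e : ℕ) :
    ∃ φ : K →+* K[X] ⧸ Ideal.span {(X : K[X]) ^ p ^ e},
      φ g = Ideal.Quotient.mk _ (C g + X) ∧
      ∀ r, ∃ P : K[X], φ r = Ideal.Quotient.mk _ P ∧ P.coeff 0 = r := by
  have hp : p.Prime := Fact.out
  induction e with
  | zero =>
    refine ⟨(Ideal.Quotient.mk _).comp C, ?_, ?_⟩
    · simp only [RingHom.comp_apply]
      rw [Ideal.Quotient.eq, Ideal.mem_span_singleton]
      simp
    · intro r
      exact ⟨C r, rfl, by simp⟩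
  | succ e ih =>
    obtain ⟨φ0, h1, h2⟩ := ih
    have hle : Ideal.span {(X : K[X]) ^ p ^ (e+1)} ≤ Ideal.span {(X : K[X]) ^ p ^ e} := by
      rw [Ideal.span_singleton_le_span_singleton]
      exact pow_dvd_pow _ (Nat.pow_le_pow_right hp.pos (Nat.le_succ e))
    have hne : Ideal.span {(X : K[X]) ^ p ^ (e+1)} ≠ ⊤ := by
      rw [Ne, Ideal.span_singleton_eq_top]
      intro h
      exact not_isUnit_X (isUnit_pow_iff (pow_ne_zero _ hp.ne_zero) |>.mp h)
    have : Nontrivial (K[X] ⧸ Ideal.span {(X : K[X]) ^ p ^ (e+1)}) :=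
      Ideal.Quotient.nontrivial_iff.mpr hne
    have : CharP (K[X] ⧸ Ideal.span {(X : K[X]) ^ p ^ (e+1)}) p :=
      charP_of_injective_ringHom ((Ideal.Quotient.mk (Ideal.span {(X : K[X]) ^ p ^ (e+1)})).comp C).injective p
    obtain ⟨φ, h3, h4⟩ := liftHom p (Ideal.Quotient.factor hle)
      (Ideal.Quotient.factor_surjective hle) (by
        intro a ha
        obtain ⟨P, rfl⟩ := Ideal.Quotient.mk_surjective a
        rw [Ideal.Quotient.factor_mk, Ideal.Quotient.eq_zero_iff_mem,
          Ideal.mem_span_singleton] at ha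
        rw [← map_pow, Ideal.Quotient.eq_zero_iff_mem, Ideal.mem_span_singleton, pow_succ, pow_mul]
        exact pow_dvd_pow_of_dvd ha p) φ0 T hT g hg (Ideal.Quotient.mk _ (C g + X))
        (by rw [h1, Ideal.Quotient.factor_mk])
    refine ⟨φ, h4, ?_⟩
    intro r
    obtain ⟨Q, hQ⟩ := Ideal.Quotient.mk_surjective (φ r)
    refine ⟨Q, hQ.symm, ?_⟩
    obtain ⟨P, hP, hP0⟩ := h2 r
    have := h3 r
    rw [← hQ, Ideal.Quotient.factor_mk, hP, Ideal.Quotient.eq, Ideal.mem_span_singleton] at this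
    have hX : (X : K[X]) ∣ Q - P := (dvd_pow_self _ (pow_ne_zero _ hp.ne_zero)).trans this
    rw [X_dvd_iff, coeff_sub, hP0, sub_eq_zero] at hX
    exact hX

/-- Krull: `b` divides `a` as soon as `a ∈ (b) + (x^n)` for all `n`. -/
theorem dvd_of_krull {R : Type u} [CommRing R] [IsLocalRing R] [IsNoetherianRing R] (x : R)
    (hx : x ∈ IsLocalRing.maximalIdeal R) (a b : R) (h : ∀ n : ℕ, ∃ s c, a = b * s + x ^ n * c) :
    b ∣ a := by
  have hne : Ideal.span {x} ≠ ⊤ := by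
    rw [Ne, Ideal.span_singleton_eq_top]; exact hx
  have hK := Ideal.iInf_pow_smul_eq_bot_of_isLocalRing (M := R ⧸ Ideal.span {b}) _ hne
  have : (Ideal.Quotient.mk (Ideal.span {b}) a) ∈
      (⨅ i : ℕ, (Ideal.span {x}) ^ i • ⊤ : Submodule R (R ⧸ Ideal.span {b})) := by
    rw [Submodule.mem_iInf]
    intro n
    obtain ⟨s, c, h⟩ := h n
    have : Ideal.Quotient.mk (Ideal.span {b}) a = x ^ n • Ideal.Quotient.mk (Ideal.span {b}) c := by
      rw [Algebra.smul_def, Ideal.Quotient.algebraMap_eq, ← map_mul, Ideal.Quotient.eq,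
        Ideal.mem_span_singleton]
      exact ⟨s, by rw [h]; ring⟩
    rw [this]
    exact Submodule.smul_mem_smul (Ideal.pow_mem_pow (Ideal.mem_span_singleton_self x) n) trivial
  rw [hK, Submodule.mem_bot, Ideal.Quotient.eq_zero_iff_mem, Ideal.mem_span_singleton] at this
  exact this

theorem exists_factor {R : Type u} [CommRing R] [IsLocalRing R] [IsNoetherianRing R] (x : R)
    (hx : x ∈ IsLocalRing.maximalIdeal R) (a : R) (ha : a ≠ 0) :
    ∃ (i : ℕ) (a' : R), a = x ^ i * a' ∧ ¬ x ∣ a' := by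
  have : FiniteMultiplicity x a := by
    by_contra hcon
    have hcon' : ∀ n : ℕ, x ^ (n+1) ∣ a := by
      intro n; by_contra h; exact hcon ⟨n, h⟩
    apply ha
    rw [← zero_dvd_iff]
    apply dvd_of_krull x hx
    intro n
    obtain ⟨c, hc⟩ := (pow_dvd_pow x (Nat.le_succ n)).trans (hcon' n)
    exact ⟨0, c, by simpa using hc⟩
  obtain ⟨c, h1, h2⟩ := this.exists_eq_pow_mul_and_not_dvd
  exact ⟨_, c, h1, h2⟩

theorem regular_domain {R : Type u} [CommRing R] [IsLocalRing R] [IsNoetherianRing R] (x : R)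
    (hx : x ∈ IsLocalRing.maximalIdeal R) (hreg : IsSMulRegular R x)
    (hdom : IsDomain (R ⧸ Ideal.span {x})) : IsDomain R := by
  have hprime : (Ideal.span {x}).IsPrime := (Ideal.Quotient.isDomain_iff_prime _).mp hdom
  have : NoZeroDivisors R := by
    constructor
    intro a b hab
    by_contra! hcon
    obtain ⟨ha, hb⟩ := hcon
    obtain ⟨i, a', rfl, ha'⟩ := exists_factor x hx a ha
    obtain ⟨j, b', rfl, hb'⟩ := exists_factor x hx b hb
    have h1 : x ^ (i + j) • (a' * b') = x ^ (i + j) • (0 : R) := by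
      rw [smul_eq_mul, smul_zero, ← hab]; ring
    have h2 := hreg.pow (i + j) h1
    have h3 : a' * b' ∈ Ideal.span {x} := by rw [h2]; exact zero_mem _
    rcases hprime.mem_or_mem h3 with h | h
    · exact ha' (Ideal.mem_span_singleton.mp h)
    · exact hb' (Ideal.mem_span_singleton.mp h)
  exact NoZeroDivisors.to_isDomain R

theorem regular_pclosed {R : Type u} [CommRing R] [IsDomain R] [IsLocalRing R] [IsNoetherianRing R]
    (p : ℕ) [Fact p.Prime] [CharP R p] (x : R)
    (hx : x ∈ IsLocalRing.maximalIdeal R) (hp : Prime x)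
    (hq : ∀ a b : R ⧸ Ideal.span {x}, b ^ p ∣ a ^ p → b ∣ a) (a b : R) (hab : b ^ p ∣ a ^ p) :
    b ∣ a := by
  have hp0 : p ≠ 0 := (Fact.out : p.Prime).ne_zero
  by_cases hb : b = 0
  · subst hb
    rw [zero_pow hp0, zero_dvd_iff] at hab
    rw [(pow_eq_zero_iff hp0).mp hab]
  obtain ⟨i, b', rfl, hb'⟩ := exists_factor x hx b hb
  clear hb
  induction i generalizing a with
  | zero =>
    rw [pow_zero, one_mul] at *
    apply dvd_of_krull x hx
    have main : ∀ n : ℕ, ∃ s c, a = b' * s + x ^ n * c ∧ b' ^ p ∣ c ^ p := by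
      intro n
      induction n with
      | zero => exact ⟨0, a, by simp, hab⟩
      | succ n ih =>
        obtain ⟨s, c, h1, h2⟩ := ih
        have h3 := hq (Ideal.Quotient.mk _ c) (Ideal.Quotient.mk _ b')
          (by rw [← map_pow, ← map_pow]; exact map_dvd _ h2)
        obtain ⟨t, ht⟩ := h3
        obtain ⟨t, rfl⟩ := Ideal.Quotient.mk_surjective t
        rw [← map_mul, Ideal.Quotient.eq, Ideal.mem_span_singleton] at ht
        obtain ⟨d, hd⟩ := ht
        have hc : c = b' * t + x * d := by rw [← hd]; ring
        refine ⟨s + x ^ n * t, d, ?_, ?_⟩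
        · rw [h1, hc]; ring
        · have h4 : b' ^ p ∣ x ^ p * d ^ p := by
            have h5 : x ^ p * d ^ p = c ^ p - b' ^ p * t ^ p := by
              rw [hc, add_pow_char, mul_pow, mul_pow]; ring
            rw [h5]
            exact dvd_sub h2 (dvd_mul_right _ _)
          obtain ⟨w, hw⟩ := h4
          have h6 : x ^ p ∣ w := hp.pow_dvd_of_dvd_mul_left p
            (fun h => hb' (hp.dvd_of_dvd_pow h)) (Dvd.intro _ hw)
          obtain ⟨v, rfl⟩ := h6
          refine ⟨v, ?_⟩
          apply mul_left_cancel₀ (pow_ne_zero p hp.ne_zero)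
          rw [hw]; ring
    intro n
    obtain ⟨s, c, h1, _⟩ := main n
    exact ⟨s, c, h1⟩
  | succ i ih =>
    have h1 : x ∣ a ^ p := by
      refine Dvd.dvd.trans ?_ hab
      refine Dvd.dvd.trans ?_ (dvd_pow_self _ hp0)
      exact Dvd.intro (x ^ i * b') (by ring)
    obtain ⟨a, rfl⟩ := hp.dvd_of_dvd_pow h1
    have h2 : (x ^ i * b') ^ p ∣ a ^ p := by
      obtain ⟨w, hw⟩ := hab
      refine ⟨w, ?_⟩
      apply mul_left_cancel₀ (pow_ne_zero p hp.ne_zero)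
      rw [← mul_pow, hw]; ring
    have h3 := mul_dvd_mul_left x (ih a h2)
    rwa [← mul_assoc, ← pow_succ'] at h3

theorem regular_main (p : ℕ) [Fact p.Prime] (n : ℕ) : ∀ (R : Type u) [CommRing R] [IsLocalRing R]
    [IsNoetherianRing R] [CharP R p] (rs : List R), rs.length = n → IsWeaklyRegular R rs →
    Ideal.span {x | x ∈ rs} = IsLocalRing.maximalIdeal R →
    IsDomain R ∧ ∀ a b : R, b ^ p ∣ a ^ p → b ∣ a := by
  have hp0 : p ≠ 0 := (Fact.out : p.Prime).ne_zero
  induction n with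
  | zero =>
    intro R _ _ _ _ rs hlen hreg hspan
    have : rs = [] := List.length_eq_zero_iff.mp hlen
    subst this
    have hbot : IsLocalRing.maximalIdeal R = ⊥ := by rw [← hspan]; simp
    have hF : IsField R := IsLocalRing.isField_iff_maximalIdeal_eq.mpr hbot
    have hd : IsDomain R := hF.isDomain
    refine ⟨hd, ?_⟩
    intro a b hab
    by_cases hb : b = 0
    · subst hb
      rw [zero_pow hp0, zero_dvd_iff] at hab
      rw [(pow_eq_zero_iff hp0).mp hab]
    · obtain ⟨c, hc⟩ := hF.mul_inv_cancel hb
      exact ⟨c * a, by rw [← mul_assoc, hc, one_mul]⟩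
  | succ n ih =>
    intro R _ _ _ _ rs hlen hreg hspan
    obtain ⟨x, rs, rfl⟩ : ∃ x l, rs = x :: l := by
      cases rs with
      | nil => simp at hlen
      | cons x l => exact ⟨x, l, rfl⟩
    have hx : x ∈ IsLocalRing.maximalIdeal R := by
      rw [← hspan]; exact Ideal.subset_span (by simp)
    rw [isWeaklyRegular_cons_iff] at hreg
    obtain ⟨hxr, hreg⟩ := hreg
    have hne : Ideal.span {x} ≠ ⊤ := by
      rw [Ne, Ideal.span_singleton_eq_top]; exact hx
    have hnt : Nontrivial (R ⧸ Ideal.span {x}) := Ideal.Quotient.nontrivial_iff.mpr hne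
    have hloc : IsLocalRing (R ⧸ Ideal.span {x}) :=
      IsLocalRing.of_surjective' (Ideal.Quotient.mk (Ideal.span {x})) Ideal.Quotient.mk_surjective
    have hch : CharP (R ⧸ Ideal.span {x}) p := by
      rw [CharP.charP_iff_prime_eq_zero Fact.out, ← map_natCast (Ideal.Quotient.mk (Ideal.span {x})),
        CharP.cast_eq_zero, map_zero]
    have hreg' : IsWeaklyRegular (R ⧸ Ideal.span {x}) rs := by
      refine (LinearEquiv.isWeaklyRegular_congr (Submodule.quotEquivOfEq _ _ ?_) rs).mp hreg
      rw [← Submodule.ideal_span_singleton_smul, smul_eq_mul, Ideal.mul_top]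
    rw [← isWeaklyRegular_map_algebraMap_iff (R ⧸ Ideal.span {x})] at hreg'
    have hmax : (IsLocalRing.maximalIdeal R).map (Ideal.Quotient.mk (Ideal.span {x})) =
        IsLocalRing.maximalIdeal (R ⧸ Ideal.span {x}) := by
      have := IsLocalHom.of_surjective (Ideal.Quotient.mk (Ideal.span {x}))
        Ideal.Quotient.mk_surjective
      ext y
      obtain ⟨y, rfl⟩ := Ideal.Quotient.mk_surjective y
      simp [sup_eq_left.mpr (IsLocalRing.le_maximalIdeal hne)]
    have hspan' : Ideal.span {y | y ∈ rs.map (algebraMap R (R ⧸ Ideal.span {x}))} =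
        IsLocalRing.maximalIdeal (R ⧸ Ideal.span {x}) := by
      rw [← hmax, ← hspan, Ideal.map_span]
      apply le_antisymm
      · apply Ideal.span_mono
        intro y hy
        simp only [List.mem_map, Set.mem_ofPred_eq] at hy
        obtain ⟨z, hz, rfl⟩ := hy
        exact ⟨z, by simp [hz], rfl⟩
      · rw [Ideal.span_le]
        rintro _ ⟨z, hz, rfl⟩
        simp only [Set.mem_ofPred_eq, List.mem_cons] at hz
        rcases hz with rfl | hz
        · have : Ideal.Quotient.mk (Ideal.span {z}) z = 0 := by
            rw [Ideal.Quotient.eq_zero_iff_mem]; exact Ideal.mem_span_singleton_self z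
          rw [this]; exact zero_mem _
        · exact Ideal.subset_span (List.mem_map_of_mem hz)
    obtain ⟨hd', hc'⟩ := ih (R ⧸ Ideal.span {x}) _ (by simpa using hlen) hreg' hspan'
    have hd : IsDomain R := regular_domain x hx hxr hd'
    refine ⟨hd, ?_⟩
    have hx0 : x ≠ 0 := by
      rintro rfl
      exact one_ne_zero (hxr (by simp : (0:R) • (1:R) = (0:R) • (0:R)))
    have hpr : Prime x := (Ideal.span_singleton_prime hx0).mp
      ((Ideal.Quotient.isDomain_iff_prime _).mp hd')
    exact regular_pclosed p x hx hpr hc'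

theorem IsDiffOp.transfer {R K : Type u} [CommRing R] [CommRing K] (ι : R →+* K)
    (hι : Function.Injective ι) (n : ℕ) : ∀ (E : K →+ K) (D : R →+ R),
    (∀ r, ι (D r) = E (ι r)) → IsDiffOp K n E → IsDiffOp R n D := by
  induction n with
  | zero =>
    intro E D h hE r s
    apply hι
    have := hE (ι r) (ι s)
    rw [h, map_mul, this, map_mul, h]
  | succ n ih =>
    intro E D h hE r
    refine ih _ _ ?_ (hE (ι r))
    intro s
    simp [h]

theorem isDiffOp_of_hom {K A : Type u} [CommRing K] [CommRing A] [Algebra K A] (I : Ideal A)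
    (φ : K →+* A) (hφ : ∀ r, φ r - algebraMap K A r ∈ I) (n : ℕ) :
    ∀ (l : A →ₗ[K] K), (∀ a ∈ I ^ (n + 1), l a = 0) →
      IsDiffOp K n (l.toAddMonoidHom.comp φ.toAddMonoidHom) := by
  have key : ∀ (l : A →ₗ[K] K) (r s : K),
      l (φ (r * s)) - r * l (φ s) = l ((φ r - algebraMap K A r) * φ s) := by
    intro l r s
    rw [sub_mul, map_sub, ← Algebra.smul_def, map_smul, map_mul, smul_eq_mul]
  induction n with
  | zero =>
    intro l hl r s
    have := key l r s
    rw [hl (_ * _) (by rw [zero_add, pow_one]; exact Ideal.mul_mem_right _ _ (hφ r)), sub_eq_zero] at this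
    exact this
  | succ n ih =>
    intro l hl r
    have := ih (l.comp (LinearMap.mulLeft K (φ r - algebraMap K A r))) (by
      intro a ha
      apply hl
      rw [LinearMap.mulLeft_apply, pow_succ' I (n + 1)]
      exact Ideal.mul_mem_mul (hφ r) ha)
    convert this using 1
    ext s
    exact key l r s

theorem IsDiffOp.sub_id {K : Type u} [CommRing K] (n : ℕ) : ∀ (E : K →+ K) (c : K),
    IsDiffOp K n E → IsDiffOp K n (E - AddMonoidHom.mulLeft c) := by
  induction n with
  | zero =>
    intro E c hE r s
    have := hE r s
    simp [this]; ring
  | succ n ih =>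
    intro E c hE r
    convert hE r using 1
    ext s
    simp; ring

theorem IsDiffOp.mulLeft {K : Type u} [CommRing K] (c : K) (n : ℕ) : ∀ (E : K →+ K),
    IsDiffOp K n E → IsDiffOp K n ((AddMonoidHom.mulLeft c).comp E) := by
  induction n with
  | zero =>
    intro E hE r s
    have := hE r s
    simp [this]; ring
  | succ n ih =>
    intro E hE r
    convert ih _ (hE r) using 1
    ext s
    simp; ring

/-- Iterated commutator with multiplication by `x`. -/
def adIter {R : Type u} [CommRing R] (x : R) (D : R →+ R) : ℕ → (R →+ R)
  | 0 => D
  | n + 1 => ((adIter x D n).comp (AddMonoidHom.mulLeft x)) -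
      ((AddMonoidHom.mulLeft x).comp (adIter x D n))

theorem adIter_isDiffOp {R : Type u} [CommRing R] (x : R) (n : ℕ) : ∀ (m : ℕ) (D : R →+ R),
    IsDiffOp R (n + m) D → IsDiffOp R n (adIter x D m) := by
  intro m
  induction m generalizing n with
  | zero => intro D h; exact h
  | succ m ih =>
    intro D h
    have := ih (n + 1) D (by convert h using 1; omega)
    exact this x

/-- Right multiplication on the endomorphism ring. -/
def endR {R : Type u} [CommRing R] (m : AddMonoid.End R) : AddMonoid.End (AddMonoid.End R) :=
  AddMonoidHom.mulRight m

/-- Left multiplication on the endomorphism ring. -/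
def endL {R : Type u} [CommRing R] (m : AddMonoid.End R) : AddMonoid.End (AddMonoid.End R) :=
  AddMonoidHom.mulLeft m

theorem endR_pow {R : Type u} [CommRing R] (m : AddMonoid.End R) (n : ℕ) (D : AddMonoid.End R) :
    (endR m ^ n) D = D * m ^ n := by
  induction n generalizing D with
  | zero => rw [pow_zero, pow_zero, mul_one]; rfl
  | succ n ih =>
    rw [pow_succ]
    change (endR m ^ n) (D * m) = _
    rw [ih, mul_assoc, pow_succ']

theorem endL_pow {R : Type u} [CommRing R] (m : AddMonoid.End R) (n : ℕ) (D : AddMonoid.End R) :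
    (endL m ^ n) D = m ^ n * D := by
  induction n generalizing D with
  | zero => rw [pow_zero, pow_zero, one_mul]; rfl
  | succ n ih =>
    rw [pow_succ]
    change (endL m ^ n) (m * D) = _
    rw [ih, ← mul_assoc, pow_succ]

theorem endR_endL_commute {R : Type u} [CommRing R] (m : AddMonoid.End R) :
    Commute (endR m) (endL m) := by
  refine DFunLike.ext _ _ fun D => ?_
  exact mul_assoc m D m

theorem adIter_end {R : Type u} [CommRing R] (x : R) (D : R →+ R) (m : ℕ) :
    adIter x D m = ((endR (AddMonoidHom.mulLeft x) - endL (AddMonoidHom.mulLeft x)) ^ m) D := by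
  induction m with
  | zero => rfl
  | succ m ih =>
    rw [pow_succ']
    change _ = (endR (AddMonoidHom.mulLeft x) - endL (AddMonoidHom.mulLeft x))
      (((endR (AddMonoidHom.mulLeft x) - endL (AddMonoidHom.mulLeft x)) ^ m) D)
    rw [← ih]
    rfl

theorem diffOp_pow_linear {R : Type u} [CommRing R] (p : ℕ) [Fact p.Prime] [CharP R p] (e : ℕ)
    (D : R →+ R) (hD : IsDiffOp R (p ^ e - 1) D) (x s : R) :
    D (x ^ p ^ e * s) = x ^ p ^ e * D s := by
  have hpos : 0 < p ^ e := pow_pos (Fact.out : p.Prime).pos e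
  have h1 : IsDiffOp R 0 (adIter x D (p ^ e - 1)) := adIter_isDiffOp x 0 _ D (by rwa [zero_add])
  have h2 : adIter x D (p ^ e) = 0 := by
    obtain ⟨m, hm⟩ : ∃ m, p ^ e = m + 1 := ⟨p ^ e - 1, by omega⟩
    rw [hm] at h1 ⊢
    ext s
    have := h1 x s
    simp only [Nat.add_sub_cancel] at this
    simp [adIter, this]
  have hR : Nontrivial R := CharP.nontrivial_of_char_ne_one (Fact.out : p.Prime).ne_one
  have : Nontrivial (AddMonoid.End R) :=
    ⟨1, 0, fun h => one_ne_zero (α := R) (DFunLike.congr_fun h 1)⟩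
  rw [adIter_end] at h2
  have : Nontrivial (AddMonoid.End (AddMonoid.End R)) :=
    ⟨1, 0, fun h => one_ne_zero (α := AddMonoid.End R) (DFunLike.congr_fun h 1)⟩
  have : CharP (AddMonoid.End (AddMonoid.End R)) p := by
    rw [CharP.charP_iff_prime_eq_zero Fact.out]
    refine DFunLike.ext _ _ fun D => DFunLike.ext _ _ fun s => ?_
    rw [AddMonoid.End.natCast_apply]
    change p • D s = 0
    rw [nsmul_eq_mul, CharP.cast_eq_zero, zero_mul]
  rw [sub_pow_char_pow_of_commute p e (endR_endL_commute _)] at h2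
  obtain ⟨m, hm⟩ : ∃ m : AddMonoid.End R, m = AddMonoidHom.mulLeft x := ⟨_, rfl⟩
  obtain ⟨D', hD'⟩ : ∃ D' : AddMonoid.End R, D' = D := ⟨_, rfl⟩
  have h3 : D' * m ^ p ^ e - m ^ p ^ e * D' = 0 := by
    rw [← endR_pow, ← endL_pow, hm, hD']
    exact h2
  have hpow : ∀ (n : ℕ) (t : R), (m ^ n) t = x ^ n * t := by
    intro n
    induction n with
    | zero => intro t; simp
    | succ n ih =>
      intro t
      have hmt : m t = x * t := by rw [hm]; rfl
      rw [pow_succ]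
      change (m ^ n) (m t) = _
      rw [hmt, ih]; ring
  have h4 : D' ((m ^ p ^ e) s) - (m ^ p ^ e) (D' s) = 0 := DFunLike.congr_fun h3 s
  rw [hpow, hpow, sub_eq_zero] at h4
  rw [hD'] at h4
  exact h4

theorem exists_root_level {K : Type u} [Field K] (p : ℕ) (f : K) (e : ℕ)
    (hf : ∀ x, f ≠ x ^ p ^ e) : ∃ s < e, ∃ g, f = g ^ p ^ s ∧ ∀ x, g ≠ x ^ p := by
  induction e with
  | zero => exact absurd (by simp) (hf f)
  | succ e ih =>
    by_cases h : ∃ x, f = x ^ p ^ e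
    · obtain ⟨g, hg⟩ := h
      refine ⟨e, Nat.lt_succ_self e, g, hg, ?_⟩
      rintro x rfl
      apply hf x
      rw [hg, ← pow_mul, pow_succ']
    · push Not at h
      obtain ⟨s, hs, g, hg⟩ := ih h
      exact ⟨s, hs.trans (Nat.lt_succ_self e), g, hg⟩

theorem exists_diffOp_field {K : Type u} [Field K] (p : ℕ) [Fact p.Prime] [CharP K p]
    (T : Finset K) (hT : ∀ E : Subfield K, (∀ c, c ^ p ∈ E) → (∀ t ∈ T, t ∈ E) → E = ⊤)
    (e : ℕ) (f : K) (hf : ∀ x, f ≠ x ^ p ^ e) :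
    ∃ D : K →+ K, IsDiffOp K (p ^ e - 1) D ∧ D 1 = 0 ∧ D f ≠ 0 := by
  have hp : p.Prime := Fact.out
  obtain ⟨s, hs, g, rfl, hg⟩ := exists_root_level p f e hf
  have htr := truncHom p T hT g hg e
  generalize hN : Ideal.span {(X : K[X]) ^ p ^ e} = N at htr
  obtain ⟨φ, h1, h2⟩ := htr
  have hφ : ∀ r, φ r - algebraMap K (K[X] ⧸ N) r ∈ Ideal.span {Ideal.Quotient.mk N X} := by
    intro r
    obtain ⟨P, hP, hP0⟩ := h2 r
    have : (X : K[X]) ∣ P - C r := by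
      rw [X_dvd_iff, coeff_sub, hP0, coeff_C_zero, sub_self]
    obtain ⟨Q, hQ⟩ := this
    rw [Ideal.mem_span_singleton]
    refine ⟨Ideal.Quotient.mk N Q, ?_⟩
    rw [← map_mul, ← hQ, map_sub, hP]
    rfl
  have hne : φ (g ^ p ^ s) - algebraMap K (K[X] ⧸ N) (g ^ p ^ s) ≠ 0 := by
    have : φ (g ^ p ^ s) - algebraMap K (K[X] ⧸ N) (g ^ p ^ s) =
        Ideal.Quotient.mk N (X ^ p ^ s) := by
      rw [map_pow, h1, ← map_pow, add_pow_char_pow, map_add, ← C_pow]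
      exact add_sub_cancel_left _ _
    rw [this, Ne, Ideal.Quotient.eq_zero_iff_mem, ← hN, Ideal.mem_span_singleton,
      pow_dvd_pow_iff X_ne_zero not_isUnit_X, not_le]
    exact Nat.pow_lt_pow_right hp.one_lt hs
  obtain ⟨l, hl⟩ : ∃ l : Module.Dual K (K[X] ⧸ N),
      l (φ (g ^ p ^ s) - algebraMap K (K[X] ⧸ N) (g ^ p ^ s)) ≠ 0 := by
    by_contra! hcon
    exact hne ((Module.forall_dual_apply_eq_zero_iff K _).mp hcon)
  have hD := isDiffOp_of_hom _ φ hφ (p ^ e - 1) l (by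
    intro a ha
    rw [Nat.sub_add_cancel (pow_pos hp.pos e), Ideal.span_singleton_pow, ← map_pow,
      Ideal.Quotient.eq_zero_iff_mem.mpr (hN ▸ Ideal.mem_span_singleton_self _),
      Ideal.mem_span_singleton, zero_dvd_iff] at ha
    rw [ha, map_zero])
  refine ⟨_, hD.sub_id _ _ (l 1), ?_, ?_⟩
  · simp
  · rw [map_sub, Algebra.algebraMap_eq_smul_one, map_smul, smul_eq_mul, mul_comm] at hl
    exact hl

theorem ffinite_pow {R : Type u} [CommRing R] (p : ℕ) [Fact p.Prime] [CharP R p]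
    (hF : Module.Finite (↥(frobenius R p).range) R) (e : ℕ) :
    ∃ T : Finset R, ∀ M : AddSubmonoid R, (∀ c, ∀ t ∈ T, c ^ p ^ e * t ∈ M) → M = ⊤ := by
  classical
  obtain ⟨S, hS⟩ := hF.fg_top
  have h1 : ∀ M : AddSubmonoid R, (∀ c, ∀ t ∈ S, c ^ p * t ∈ M) → M = ⊤ := by
    intro M hM
    rw [eq_top_iff]
    intro r _
    have hr : r ∈ Submodule.span (↥(frobenius R p).range) (S : Set R) := by rw [hS]; trivial
    have hr' : ∀ c : R, c ^ p * r ∈ M := by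
      induction hr using Submodule.span_induction with
      | mem x hx => exact fun c => hM c x hx
      | zero => intro c; simp
      | add x y _ _ hx hy => 
        intro c
        rw [mul_add]
        exact add_mem (hx trivial c) (hy trivial c)
      | smul a x _ hx =>
        intro c
        obtain ⟨_, d, rfl⟩ := a
        change c ^ p * (d ^ p * x) ∈ M
        rw [← mul_assoc, ← mul_pow]
        exact hx trivial _
    simpa using hr' 1
  induction e with
  | zero =>
    refine ⟨{1}, fun M hM => ?_⟩
    rw [eq_top_iff]
    intro r _
    simpa using hM r 1 (by simp)
  | succ e ih =>
    obtain ⟨T, hT⟩ := ih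
    refine ⟨(S ×ˢ T).image (fun x => x.1 ^ p ^ e * x.2), fun M hM => ?_⟩
    apply hT
    intro c t ht
    let φ : R →+ R := (AddMonoidHom.mulRight t).comp (iterateFrobenius R p e).toAddMonoidHom
    have : M.comap φ = ⊤ := by
      apply h1
      intro d s hs
      have := hM d (s ^ p ^ e * t) (Finset.mem_image.mpr ⟨(s, t), by simp [hs, ht], rfl⟩)
      rw [AddSubmonoid.mem_comap]
      convert this using 1
      simp only [φ, AddMonoidHom.comp_apply, AddMonoidHom.coe_mulRight, RingHom.toAddMonoidHom_eq_coe,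
        AddMonoidHom.coe_coe, iterateFrobenius_def]
      rw [mul_pow, ← pow_mul, pow_succ']; ring
    have hc : c ∈ M.comap φ := by rw [this]; trivial
    exact hc

end

/-- In an `F`-finite regular local ring of characteristic `p > 0` with `q = p ^ e`,
`R ^ q` is exactly the set of elements killed by all differential operators of order at
most `q - 1` annihilating `1`. -/
theorem powQ_eq_diffOp_kernel
    (R : Type*) [CommRing R] [IsDomain R] [IsLocalRing R] (hreg : IsRegularLocal R)
    (p : ℕ) [Fact p.Prime] [CharP R p]
    (hF : Module.Finite (↥(frobenius R p).range) R)
    (e q : ℕ) (hq : q = p ^ e) (f : R) :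
    (∃ x : R, f = x ^ q) ↔
      ∀ D : R →+ R, IsDiffOp R (q - 1) D → D 1 = 0 → D f = 0 := by
  classical
  subst hq
  constructor
  · rintro ⟨x, rfl⟩ D hD h1
    have := diffOp_pow_linear p e D hD x 1
    rwa [mul_one, h1, mul_zero] at this
  intro H
  by_contra! hf
  obtain ⟨hN, rs, hrs, hspan⟩ := hreg
  obtain ⟨-, hcl⟩ := regular_main p rs.length R rs rfl hrs.toIsWeaklyRegular hspan
  have hcl' : ∀ n (a b : R), b ^ p ^ n ∣ a ^ p ^ n → b ∣ a := by
    intro n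
    induction n with
    | zero => intro a b h; simpa using h
    | succ n ih =>
      intro a b h
      apply ih
      apply hcl
      rwa [← pow_mul, ← pow_mul, ← pow_succ]
  let K := FractionRing R
  let ι := algebraMap R K
  have hι : Function.Injective ι := IsFractionRing.injective R K
  have : CharP K p := charP_of_injective_ringHom hι p
  obtain ⟨S, hS⟩ := ffinite_pow p hF 1
  obtain ⟨D, hD, hD1, hDf⟩ := exists_diffOp_field p (S.image ι) (by
    intro E hE1 hE2
    have h1 : E.toSubring.toAddSubgroup.toAddSubmonoid.comap ι.toAddMonoidHom = ⊤ := by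
      apply hS
      intro c t ht
      change ι (c ^ p ^ 1 * t) ∈ E
      rw [pow_one, map_mul, map_pow]
      exact mul_mem (hE1 _) (hE2 _ (Finset.mem_image_of_mem _ ht))
    have h2 : ∀ r, ι r ∈ E := by
      intro r
      have : r ∈ E.toSubring.toAddSubgroup.toAddSubmonoid.comap ι.toAddMonoidHom := by
        rw [h1]; trivial
      exact this
    rw [eq_top_iff]
    intro x _
    obtain ⟨a, b, hb, rfl⟩ := IsFractionRing.div_surjective (A := R) x
    exact div_mem (h2 a) (h2 b)) e (ι f) (by
    intro x hx
    obtain ⟨a, b, hb, rfl⟩ := IsFractionRing.div_surjective (A := R) x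
    have hb0 : ι b ≠ 0 := by
      rw [Ne, map_eq_zero_iff ι hι]; exact nonZeroDivisors.ne_zero hb
    rw [div_pow, eq_div_iff (pow_ne_zero _ hb0), ← map_pow, ← map_pow, ← map_mul] at hx
    have h1 := hι hx
    obtain ⟨c, rfl⟩ := hcl' e a b ⟨f, by rw [← h1, mul_comm]⟩
    apply hf c
    rw [mul_pow, mul_comm] at h1
    exact mul_left_cancel₀ (pow_ne_zero _ (nonZeroDivisors.ne_zero hb)) h1)
  obtain ⟨T, hT⟩ := ffinite_pow p hF e
  obtain ⟨c, hc⟩ := IsLocalization.exist_integer_multiples_of_finset (nonZeroDivisors R)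
    (T.image (fun t => D (ι t)))
  have hc0 : ι c ≠ 0 := by
    rw [Ne, map_eq_zero_iff ι hι]; exact nonZeroDivisors.ne_zero c.2
  let E : K →+ K := (AddMonoidHom.mulLeft (ι c)).comp D
  have hE : IsDiffOp K (p ^ e - 1) E := hD.mulLeft _ _
  have hintegral : ∀ r, ∃ r', ι r' = E (ι r) := by
    have h1 : (ι.range.toAddSubgroup.toAddSubmonoid).comap (E.comp ι.toAddMonoidHom) = ⊤ := by
      apply hT
      intro d t ht
      obtain ⟨w, hw⟩ := hc _ (Finset.mem_image_of_mem _ ht)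
      refine ⟨d ^ p ^ e * w, ?_⟩
      change _ = ι c * D (ι (d ^ p ^ e * t))
      rw [map_mul, map_mul, map_pow, diffOp_pow_linear p e D hD, show ι w = _ from hw,
        Algebra.smul_def]
      ring
    intro r
    have : r ∈ (ι.range.toAddSubgroup.toAddSubmonoid).comap (E.comp ι.toAddMonoidHom) := by
      rw [h1]; trivial
    exact this
  choose D' hD' using hintegral
  let D'' : R →+ R :=
    { toFun := D'
      map_zero' := by apply hι; rw [hD']; simp
      map_add' := by intro x y; apply hι; rw [hD', map_add, map_add, map_add, hD', hD'] }
  have h1 := H D'' (IsDiffOp.transfer ι hι _ E D'' hD' hE) (by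
    apply hι
    change ι (D' 1) = _
    rw [hD', map_one]
    change ι c * D 1 = _
    rw [hD1, mul_zero, map_zero])
  have h2 : ι c * D (ι f) = 0 := by
    have : ι (D' f) = ι c * D (ι f) := hD' f
    rw [← this]
    change ι (D'' f) = 0
    rw [h1, map_zero]
  exact (mul_ne_zero hc0 hDf) h2
end
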